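/- arXiv:2603.09388 — 2 statements merged into one kernel-verified Lean document; each statement's English description precedes it below -/
import Mathlib

section
/- Let p : ℝ^n → [1,∞) be measurable with p_+ < ∞ and suppose p(·) satisfies the A_∞ condition. Then there exist γ > 1, constants A, δ > 0, and a function b from the set of all axis-parallel cubes to [0,∞) with ∑_{Q∈F} b(Q) ≤ 2 for every family F of pairwise disjoint cubes, such that for every cube Q and every t ∈ (0, 1/‖χ_Q‖_{p(·)}], one has |Q| ( (1/|Q|) ∫_Q t^{γ p(x)} dx )^{1/γ} ≤ A ( ∫_Q t^{p(x)} dx + t^δ b(Q) 1_{(0,1)}(t) ). -/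
open MeasureTheory ENNReal Set

noncomputable section

/-- An axis-parallel cube in `ℝⁿ`, given by its center and (positive) side length. -/
structure RCube (n : ℕ) where
  center : Fin n → ℝ
  side : ℝ
  side_pos : 0 < side

namespace RCube

/-- The (closed) cube as a subset of `ℝⁿ`. -/
def toSet {n : ℕ} (Q : RCube n) : Set (Fin n → ℝ) :=
  {x | ∀ i, |x i - Q.center i| ≤ Q.side / 2}

/-- `rQ`: the cube concentric with `Q` whose side length is `r` times that of `Q`. -/
def scaledSet {n : ℕ} (Q : RCube n) (r : ℝ) : Set (Fin n → ℝ) :=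
  {x | ∀ i, |x i - Q.center i| ≤ r * Q.side / 2}

end RCube

/-- A family of pairwise disjoint cubes. -/
def PairwiseDisjointCubes {n : ℕ} (F : Set (RCube n)) : Prop :=
  F.Pairwise fun Q₁ Q₂ => Disjoint Q₁.toSet Q₂.toSet

/-- The variable Lebesgue norm `‖f‖_{p(·)}` for a real-valued (finite) exponent,
applied to an `ℝ≥0∞`-valued function: `inf {λ > 0 : ∫ (f/λ)^{p(x)} dx ≤ 1}`. -/
def vnorm {n : ℕ} (p : (Fin n → ℝ) → ℝ) (f : (Fin n → ℝ) → ℝ≥0∞) : ℝ≥0∞ :=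
  sInf {lam : ℝ≥0∞ | 0 < lam ∧ (∫⁻ x, (f x / lam) ^ p x) ≤ 1}

/-- `t^e` for `t, e ∈ [0,∞]`, with the standard variable-exponent convention
`t^∞ = 0` for `t ≤ 1` and `t^∞ = ∞` for `t > 1`. -/
def epow (t e : ℝ≥0∞) : ℝ≥0∞ :=
  if e = ∞ then (if t ≤ 1 then 0 else ∞) else t ^ e.toReal

/-- The variable Lebesgue norm for an exponent with values in `[1,∞]`. -/
def vnormE {n : ℕ} (p : (Fin n → ℝ) → ℝ≥0∞) (f : (Fin n → ℝ) → ℝ≥0∞) : ℝ≥0∞ :=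
  sInf {lam : ℝ≥0∞ | 0 < lam ∧ (∫⁻ x, epow (f x / lam) (p x)) ≤ 1}

/-- `|f|` as an `ℝ≥0∞`-valued function. -/
def ofR {n : ℕ} (f : (Fin n → ℝ) → ℝ) : (Fin n → ℝ) → ℝ≥0∞ :=
  fun x => ENNReal.ofReal |f x|

/-- The `ℝ≥0∞`-valued characteristic function of a set. -/
def chiE {n : ℕ} (S : Set (Fin n → ℝ)) : (Fin n → ℝ) → ℝ≥0∞ :=
  S.indicator fun _ => 1

/-- The Hardy--Littlewood maximal operator (over axis-parallel cubes containing `x`). -/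
def hlMaximal {n : ℕ} (f : (Fin n → ℝ) → ℝ) (x : Fin n → ℝ) : ℝ≥0∞ :=
  ⨆ (Q : RCube n) (_ : x ∈ Q.toSet),
    (∫⁻ y in Q.toSet, ENNReal.ofReal |f y|) / volume Q.toSet

/-- `M` is bounded on `L^{p(·)}`: there is `C > 0` with `‖Mf‖_{p(·)} ≤ C ‖f‖_{p(·)}`
for every `f ∈ L^{p(·)}`. -/
def MaximalBounded {n : ℕ} (p : (Fin n → ℝ) → ℝ) : Prop :=
  ∃ C > (0 : ℝ), ∀ f : (Fin n → ℝ) → ℝ, Measurable f → vnorm p (ofR f) < ∞ →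
    vnorm p (hlMaximal f) ≤ ENNReal.ofReal C * vnorm p (ofR f)

/-- The function `∑_{Q ∈ F} t_Q χ_{E_Q}` (for a pairwise disjoint family,
written as a pointwise supremum). -/
def cubeSum {n : ℕ} (F : Set (RCube n)) (t : RCube n → ℝ)
    (E : RCube n → Set (Fin n → ℝ)) (x : Fin n → ℝ) : ℝ≥0∞ :=
  ⨆ (Q : RCube n) (_ : Q ∈ F) (_ : x ∈ E Q), ENNReal.ofReal (t Q)

/-- `p(·)` satisfies the `A_∞` condition with parameter `lam` and constant `C`. -/
def AInftyWith {n : ℕ} (p : (Fin n → ℝ) → ℝ) (lam C : ℝ) : Prop :=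
  ∀ F : Set (RCube n), PairwiseDisjointCubes F →
    ∀ t : RCube n → ℝ, (∀ Q ∈ F, 0 ≤ t Q) →
      ∀ E : RCube n → Set (Fin n → ℝ),
        (∀ Q ∈ F, MeasurableSet (E Q) ∧ E Q ⊆ Q.toSet ∧
          ENNReal.ofReal lam * volume Q.toSet ≤ volume (E Q)) →
        vnorm p (cubeSum F t RCube.toSet) ≤ ENNReal.ofReal C * vnorm p (cubeSum F t E)

/-- The `A_∞` condition for a real-valued exponent. -/
def AInfty {n : ℕ} (p : (Fin n → ℝ) → ℝ) : Prop :=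
  ∃ lam ∈ Ioo (0 : ℝ) 1, ∃ C > (0 : ℝ), AInftyWith p lam C

/-- `p(·)` satisfies the `A_∞` condition with parameter `lam` and constant `C`
(exponent with values in `[1,∞]`). -/
def AInftyWithE {n : ℕ} (p : (Fin n → ℝ) → ℝ≥0∞) (lam C : ℝ) : Prop :=
  ∀ F : Set (RCube n), PairwiseDisjointCubes F →
    ∀ t : RCube n → ℝ, (∀ Q ∈ F, 0 ≤ t Q) →
      ∀ E : RCube n → Set (Fin n → ℝ),
        (∀ Q ∈ F, MeasurableSet (E Q) ∧ E Q ⊆ Q.toSet ∧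
          ENNReal.ofReal lam * volume Q.toSet ≤ volume (E Q)) →
        vnormE p (cubeSum F t RCube.toSet) ≤ ENNReal.ofReal C * vnormE p (cubeSum F t E)

/-- The `A_∞` condition for an exponent with values in `[1,∞]`. -/
def AInftyE {n : ℕ} (p : (Fin n → ℝ) → ℝ≥0∞) : Prop :=
  ∃ lam ∈ Ioo (0 : ℝ) 1, ∃ C > (0 : ℝ), AInftyWithE p lam C

/-- The nonincreasing-rearrangement value `(f χ_Q)^*(s) = inf {α : |{x ∈ Q : |f x| > α}| ≤ s}`. -/
def rearr {n : ℕ} (f : (Fin n → ℝ) → ℝ) (Q : RCube n) (s : ℝ≥0∞) : ℝ≥0∞ :=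
  sInf {a : ℝ≥0∞ | volume {x | x ∈ Q.toSet ∧ a < ENNReal.ofReal |f x|} ≤ s}

/-- The `λ`-median maximal operator `m_λ`. -/
def medianMax {n : ℕ} (lam : ℝ) (f : (Fin n → ℝ) → ℝ) (x : Fin n → ℝ) : ℝ≥0∞ :=
  ⨆ (Q : RCube n) (_ : x ∈ Q.toSet), rearr f Q (ENNReal.ofReal lam * volume Q.toSet)

/-- The modified median maximal operator `m_{τ,r}` (supremum over cubes `Q` with `x ∈ rQ`). -/
def medianMaxR {n : ℕ} (tau r : ℝ) (f : (Fin n → ℝ) → ℝ) (x : Fin n → ℝ) : ℝ≥0∞ :=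
  ⨆ (Q : RCube n) (_ : x ∈ Q.scaledSet r), rearr f Q (ENNReal.ofReal tau * volume Q.toSet)

/-- The average `⟨f⟩_Q = (1/|Q|) ∫_Q f`. -/
def cubeAvg {n : ℕ} (f : (Fin n → ℝ) → ℝ) (Q : RCube n) : ℝ :=
  (∫ y in Q.toSet, f y) / (volume Q.toSet).toReal

/-- `|T_F f|` for a pairwise disjoint family `F`, written as a pointwise supremum. -/
def avgSum {n : ℕ} (F : Set (RCube n)) (f : (Fin n → ℝ) → ℝ) (x : Fin n → ℝ) : ℝ≥0∞ :=
  ⨆ (Q : RCube n) (_ : Q ∈ F) (_ : x ∈ Q.toSet), ENNReal.ofReal |cubeAvg f Q|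

/-- The reverse Hölder condition `RH`. -/
def RHCond {n : ℕ} (p : (Fin n → ℝ) → ℝ) : Prop :=
  ∃ r : ℝ, 1 < r ∧ ∃ C : ℝ, 0 < C ∧
    ∀ S : Set (RCube n), PairwiseDisjointCubes S →
      ∀ t : RCube n → ℝ, (∀ Q ∈ S, 0 ≤ t Q) →
        (∑' Q : S, ∫⁻ x in Q.1.toSet, ENNReal.ofReal (t Q.1) ^ p x) ≤ 1 →
        (∑' Q : S, volume Q.1.toSet *
            ((∫⁻ x in Q.1.toSet, ENNReal.ofReal (t Q.1) ^ (r * p x)) / volume Q.1.toSet)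
              ^ (1 / r)) ≤ ENNReal.ofReal C


namespace RCube

/-- The open cube. -/
def op {n : ℕ} (Q : RCube n) : Set (Fin n → ℝ) := Metric.ball Q.center (Q.side / 2)

lemma toSet_eq {n : ℕ} (Q : RCube n) : Q.toSet = Metric.closedBall Q.center (Q.side / 2) := by
  ext x
  have := Q.side_pos
  simp only [toSet, mem_ofPred_eq, Metric.mem_closedBall]
  rw [dist_pi_le_iff (by linarith)]
  simp [Real.dist_eq]

lemma mem_op {n : ℕ} (Q : RCube n) (x : Fin n → ℝ) :
    x ∈ Q.op ↔ ∀ i, |x i - Q.center i| < Q.side / 2 := by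
  have := Q.side_pos
  simp only [op, Metric.mem_ball]
  rw [dist_pi_lt_iff (by linarith)]
  simp [Real.dist_eq]

lemma isOpen_op {n : ℕ} (Q : RCube n) : IsOpen Q.op := Metric.isOpen_ball

lemma meas_op {n : ℕ} (Q : RCube n) : MeasurableSet Q.op := Q.isOpen_op.measurableSet

lemma meas_toSet {n : ℕ} (Q : RCube n) : MeasurableSet Q.toSet := by
  rw [toSet_eq]; exact Metric.isClosed_closedBall.measurableSet

lemma op_subset {n : ℕ} (Q : RCube n) : Q.op ⊆ Q.toSet := by
  rw [toSet_eq]; exact Metric.ball_subset_closedBall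

lemma center_mem {n : ℕ} (Q : RCube n) : Q.center ∈ Q.op :=
  Metric.mem_ball_self (by have := Q.side_pos; linarith)

lemma toSet_diff {n : ℕ} (Q : RCube n) : volume (Q.toSet \ Q.op) = 0 := by
  rw [toSet_eq, op, Metric.closedBall_sdiff_ball]
  exact Measure.addHaar_sphere_of_ne_zero _ _ (by have := Q.side_pos; linarith)

lemma op_ae {n : ℕ} (Q : RCube n) : Q.op =ᵐ[volume] Q.toSet := by
  refine Filter.EventuallyLE.antisymm (LE.le.eventuallyLE Q.op_subset) ?_
  rw [ae_le_set]
  exact Q.toSet_diff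

lemma vol_op {n : ℕ} (Q : RCube n) : volume Q.op = ENNReal.ofReal (Q.side ^ n) := by
  rw [op, Real.volume_pi_ball _ (by have := Q.side_pos; linarith)]
  simp; congr 2; ring

lemma vol_toSet {n : ℕ} (Q : RCube n) : volume Q.toSet = ENNReal.ofReal (Q.side ^ n) := by
  rw [← measure_congr Q.op_ae, vol_op]

lemma vol_eq {n : ℕ} (Q : RCube n) : volume Q.toSet = volume Q.op := by
  rw [vol_op, vol_toSet]

lemma vol_ne_zero {n : ℕ} (Q : RCube n) : volume Q.op ≠ 0 := by
  rw [vol_op]; have := Q.side_pos; positivity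

lemma vol_ne_top {n : ℕ} (Q : RCube n) : volume Q.op ≠ ∞ := by
  rw [vol_op]; exact ofReal_ne_top

lemma setL {n : ℕ} (Q : RCube n) (f : (Fin n → ℝ) → ℝ≥0∞) :
    ∫⁻ x in Q.toSet, f x = ∫⁻ x in Q.op, f x := (setLIntegral_congr Q.op_ae).symm

/-- dyadic coordinate -/
def dz {n : ℕ} (P : RCube n) (m : ℕ) (x : Fin n → ℝ) (i : Fin n) : ℤ :=
  ⌊(x i - P.center i + P.side / 2) * 2 ^ m / P.side⌋

/-- dyadic cube containing `x` -/
def dc {n : ℕ} (P : RCube n) (m : ℕ) (x : Fin n → ℝ) : RCube n where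
  center := fun i => P.center i - P.side / 2 + (P.dz m x i + 1 / 2) * (P.side / 2 ^ m)
  side := P.side / 2 ^ m
  side_pos := by have := P.side_pos; positivity

lemma dz_of_mem {n : ℕ} (P : RCube n) (m : ℕ) (x y : Fin n → ℝ) (h : y ∈ (P.dc m x).op) :
    P.dz m y = P.dz m x := by
  rw [mem_op] at h
  ext i
  have h := h i
  have hs := P.side_pos
  have h2 : (0 : ℝ) < 2 ^ m := by positivity
  simp only [dc] at h
  rw [abs_lt] at h
  generalize P.dz m x i = k at *
  rw [dz, Int.floor_eq_iff]
  have e : P.side = (P.side / 2 ^ m) * 2 ^ m := by field_simp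
  set d := P.side / 2 ^ m with hd
  have hdp : 0 < d := by positivity
  have e2 : (y i - P.center i + P.side / 2) * 2 ^ m / P.side
      = (y i - P.center i + P.side / 2) / d := by rw [hd]; field_simp
  rw [e2]
  constructor
  · rw [le_div_iff₀ hdp]; nlinarith
  · rw [div_lt_iff₀ hdp]; nlinarith

lemma mem_of_dz {n : ℕ} (P : RCube n) (m : ℕ) (x y : Fin n → ℝ) (h : P.dz m y = P.dz m x) :
    y ∈ (P.dc m x).toSet := by
  intro i
  have h := congrFun h i
  have hs := P.side_pos
  have h2 : (0 : ℝ) < 2 ^ m := by positivity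
  simp only [dc]
  generalize P.dz m x i = k at *
  rw [dz, Int.floor_eq_iff] at h
  set d := P.side / 2 ^ m with hd
  have hdp : 0 < d := by positivity
  have e2 : (y i - P.center i + P.side / 2) * 2 ^ m / P.side
      = (y i - P.center i + P.side / 2) / d := by rw [hd]; field_simp
  rw [e2, le_div_iff₀ hdp, div_lt_iff₀ hdp] at h
  rw [abs_le]
  constructor <;> nlinarith [h.1, h.2]

lemma dz_succ {n : ℕ} (P : RCube n) (m : ℕ) (x y : Fin n → ℝ)
    (h : P.dz (m + 1) y = P.dz (m + 1) x) : P.dz m y = P.dz m x := by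
  have key : ∀ x i, P.dz m x i = P.dz (m + 1) x i / 2 := by
    intro x i
    simp only [dz]
    have := Int.floor_div_natCast ((x i - P.center i + P.side / 2) * 2 ^ (m + 1) / P.side) 2
    push_cast at this
    rw [← this]
    congr 1
    rw [pow_succ]; ring
  ext i
  rw [key, key, h]

lemma dz_le {n : ℕ} (P : RCube n) (m l : ℕ) (hl : l ≤ m) (x y : Fin n → ℝ)
    (h : P.dz m y = P.dz m x) : P.dz l y = P.dz l x := by
  induction m, hl using Nat.le_induction with
  | base => exact h
  | succ m _ ih => exact ih (P.dz_succ m x y h)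

lemma dc_congr {n : ℕ} (P : RCube n) (m : ℕ) (x y : Fin n → ℝ)
    (h : P.dz m y = P.dz m x) : P.dc m y = P.dc m x := by
  simp only [dc, h]

lemma dc_zero {n : ℕ} (P : RCube n) (x : Fin n → ℝ) (h : x ∈ P.op) : P.dc 0 x = P := by
  have hs := P.side_pos
  have : ∀ i, P.dz 0 x i = 0 := by
    intro i
    rw [mem_op] at h
    have h := h i
    rw [abs_lt] at h
    rw [dz, Int.floor_eq_iff]
    constructor
    · have : 0 ≤ x i - P.center i + P.side / 2 := by linarith
      push_cast; positivity
    · rw [div_lt_iff₀ hs]; push_cast; linarith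
  simp only [dc, this]
  cases P
  simp
  ext i
  ring

lemma subset_op_of {n : ℕ} (P R : RCube n) (h : R.op ⊆ P.toSet) : R.op ⊆ P.op := by
  have h1 : R.op ⊆ interior P.toSet := interior_maximal h R.isOpen_op
  rwa [toSet_eq, interior_closedBall] at h1
  have := P.side_pos; linarith

lemma dc_succ_subset {n : ℕ} (P : RCube n) (m : ℕ) (x : Fin n → ℝ) :
    (P.dc (m + 1) x).op ⊆ (P.dc m x).op := by
  apply subset_op_of
  intro y hy
  exact P.mem_of_dz m x y (P.dz_succ m x y (P.dz_of_mem _ x y hy))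

lemma dc_subset {n : ℕ} (P : RCube n) (m : ℕ) (x : Fin n → ℝ) (h : x ∈ P.op) :
    (P.dc m x).op ⊆ P.op := by
  induction m with
  | zero => rw [P.dc_zero x h]
  | succ m ih => exact (P.dc_succ_subset m x).trans ih

lemma dc_vol {n : ℕ} (P : RCube n) (m : ℕ) (x : Fin n → ℝ) :
    volume (P.dc m x).op = 2 ^ n * volume (P.dc (m + 1) x).op := by
  have hs := P.side_pos
  rw [vol_op, vol_op]
  have : (2 : ℝ≥0∞) ^ n = ENNReal.ofReal (2 ^ n) := by
    rw [ENNReal.ofReal_pow (by norm_num)]; simp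
  rw [this, ← ENNReal.ofReal_mul (by positivity)]
  congr 1
  simp only [dc]
  rw [← mul_pow]
  congr 1
  rw [pow_succ]; field_simp

end RCube

lemma disj_countable {n : ℕ} (D : Set (RCube n)) (h : D.PairwiseDisjoint RCube.op) :
    D.Countable :=
  h.countable_of_isOpen (fun Q _ => Q.isOpen_op) (fun Q _ => ⟨_, Q.center_mem⟩)

/-- Calderon-Zygmund decomposition. -/
lemma cz {n : ℕ} (P : RCube n) (f : (Fin n → ℝ) → ℝ≥0∞) (hf : Measurable f) (T : ℝ≥0∞)
    (hfin : ∫⁻ x in P.op, f x ≠ ∞) (hT : ∫⁻ x in P.op, f x ≤ T * volume P.op) :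
    ∃ D : Set (RCube n), D.PairwiseDisjoint RCube.op ∧
      (∀ R ∈ D, R.op ⊆ P.op ∧ T * volume R.op ≤ ∫⁻ x in R.op, f x ∧
        ∫⁻ x in R.op, f x ≤ 2 ^ n * T * volume R.op) ∧
      ∀ᵐ x, x ∈ P.op → x ∉ ⋃ R ∈ D, R.op → f x ≤ T := by
  classical
  let W : ℕ → (Fin n → ℝ) → Prop := fun m x =>
    T * volume (P.dc m x).op < ∫⁻ y in (P.dc m x).op, f y
  have hW0 : ∀ x ∈ P.op, ¬ W 0 x := by
    intro x hx
    simp only [W, P.dc_zero x hx, not_lt]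
    exact hT
  have hWc : ∀ m x y, P.dz m y = P.dz m x → (W m y ↔ W m x) := by
    intro m x y h
    simp only [W, P.dc_congr m x y h]
  -- stopping predicate
  let St : ℕ → (Fin n → ℝ) → Prop := fun m x => W m x ∧ ∀ l < m, ¬ W l x
  have hStc : ∀ m x y, P.dz m y = P.dz m x → St m x → St m y := by
    intro m x y h hx
    refine ⟨(hWc m x y h).2 hx.1, fun l hl => ?_⟩
    rw [hWc l x y (P.dz_le m l hl.le x y h)]
    exact hx.2 l hl
  have hStu : ∀ m l x, St m x → St l x → m = l := by
    intro m l x h1 h2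
    rcases lt_trichotomy m l with h | h | h
    · exact absurd h1.1 (h2.2 m h)
    · exact h
    · exact absurd h2.1 (h1.2 l h)
  let D : Set (RCube n) := {R | ∃ x ∈ P.op, ∃ m, St m x ∧ R = P.dc m x}
  have hdisj : D.PairwiseDisjoint RCube.op := by
    rintro R ⟨x, hx, m, hm, rfl⟩ R' ⟨y, hy, l, hl, rfl⟩ hne
    rw [Function.onFun, Set.disjoint_left]
    intro v hv hv'
    have e1 := P.dz_of_mem m x v hv
    have e2 := P.dz_of_mem l y v hv'
    have : m = l := hStu m l v (hStc m x v e1 hm) (hStc l y v e2 hl)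
    subst this
    exact hne ((P.dc_congr m x v e1).symm.trans (P.dc_congr m y v e2))
  refine ⟨D, hdisj, ?_, ?_⟩
  · rintro R ⟨x, hx, m, hm, rfl⟩
    refine ⟨P.dc_subset m x hx, hm.1.le, ?_⟩
    rcases m with _ | m
    · exact absurd hm.1 (hW0 x hx)
    · have h1 := hm.2 m (Nat.lt_succ_self m)
      simp only [W, not_lt] at h1
      calc _ ≤ ∫⁻ y in (P.dc m x).op, f y := lintegral_mono_set (P.dc_succ_subset m x)
        _ ≤ _ := h1
        _ = _ := by rw [P.dc_vol]; ring
  · have hbd : ∀ᵐ x, ∀ R ∈ D, x ∉ R.toSet \ R.op := by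
      rw [ae_ball_iff (disj_countable D hdisj)]
      intro R _
      exact measure_eq_zero_iff_ae_notMem.1 R.toSet_diff
    have hdiff := VitaliFamily.ae_tendsto_lintegral_div
      (IsUnifLocDoublingMeasure.vitaliFamily (volume : Measure (Fin n → ℝ)) 1)
      (f := P.op.indicator f) (hf.indicator P.meas_op).aemeasurable
      (by rwa [lintegral_indicator P.meas_op])
    filter_upwards [hbd, hdiff] with x hb hd hx hxn
    by_cases hst : ∃ m, W m x
    · exfalso
      have hS : St (Nat.find hst) x := ⟨Nat.find_spec hst, fun l hl => Nat.find_min hst hl⟩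
      have hR : P.dc (Nat.find hst) x ∈ D := ⟨x, hx, _, hS, rfl⟩
      refine hb _ hR ⟨P.mem_of_dz _ x x rfl, fun h => hxn ?_⟩
      exact mem_biUnion hR h
    · push Not at hst
      have ht := IsUnifLocDoublingMeasure.tendsto_closedBall_filterAt
        (volume : Measure (Fin n → ℝ)) (K := 1) (x := x) (l := Filter.atTop)
        (fun m => (P.dc m x).center) (fun m => (P.dc m x).side / 2)
        (by
          rw [tendsto_nhdsWithin_iff]
          constructor
          · have : Filter.Tendsto (fun m : ℕ => P.side / 2 * (1 / 2 : ℝ) ^ m) Filter.atTop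
                (nhds (P.side / 2 * 0)) :=
              (tendsto_pow_atTop_nhds_zero_of_lt_one (r := (1 / 2 : ℝ)) (by norm_num)
                (by norm_num)).const_mul _
            rw [mul_zero] at this
            refine this.congr fun m => ?_
            simp only [RCube.dc]
            rw [div_pow, one_pow]; ring
          · exact Filter.Eventually.of_forall fun m => by
              have := (P.dc m x).side_pos
              simpa using this)
        (Filter.Eventually.of_forall fun m => by
          have := P.mem_of_dz m x x rfl
          rw [RCube.toSet_eq] at this
          simpa using this)
      have h2 := hd.comp ht
      rw [indicator_of_mem hx] at h2
      refine le_of_tendsto' h2 fun m => ?_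
      simp only [Function.comp]
      rw [← RCube.toSet_eq, RCube.setL, RCube.vol_eq]
      apply ENNReal.div_le_of_le_mul
      refine le_trans ?_ (not_lt.1 (hst m))
      exact lintegral_mono fun y => indicator_le_self _ _ _

/-- union of the open cubes of a family -/
def opU {n : ℕ} (D : Set (RCube n)) : Set (Fin n → ℝ) := ⋃ R ∈ D, R.op

lemma opU_meas {n : ℕ} (D : Set (RCube n)) : MeasurableSet (opU D) :=
  (isOpen_biUnion fun R _ => R.isOpen_op).measurableSet

lemma gen {n : ℕ} (f : (Fin n → ℝ) → ℝ≥0∞) (hf : Measurable f)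
    (hpos : ∀ P : RCube n, ∫⁻ x in P.op, f x ≠ 0) (hfin : ∀ P : RCube n, ∫⁻ x in P.op, f x ≠ ∞)
    (a : ℝ≥0∞) (ha : 1 ≤ a) (hat : a ≠ ∞) (Q : RCube n) :
    ∃ D : ℕ → Set (RCube n), D 0 = {Q} ∧ (∀ k, (D k).PairwiseDisjoint RCube.op) ∧
      (∀ k, opU (D (k + 1)) ⊆ opU (D k)) ∧
      (∀ k, opU (D k) ⊆ Q.op) ∧
      (∀ k, ∀ P ∈ D k, a * volume (P.op ∩ opU (D (k + 1))) ≤ volume P.op) ∧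
      ∀ k, ∀ᵐ x, x ∈ opU (D k) → x ∉ opU (D (k + 1)) →
        f x ≤ a * ((2 ^ n * a) ^ k * ((∫⁻ x in Q.op, f x) / volume Q.op)) := by
  let av : RCube n → ℝ≥0∞ := fun P => (∫⁻ x in P.op, f x) / volume P.op
  have hav : ∀ P, av P * volume P.op = ∫⁻ x in P.op, f x := fun P =>
    ENNReal.div_mul_cancel P.vol_ne_zero P.vol_ne_top
  have hav0 : ∀ P, av P ≠ 0 := fun P =>
    (ENNReal.div_pos (hpos P) P.vol_ne_top).ne'
  have havt : ∀ P, av P ≠ ∞ := fun P => ENNReal.div_ne_top (hfin P) P.vol_ne_zero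
  have hcz : ∀ P : RCube n, ∃ D : Set (RCube n), D.PairwiseDisjoint RCube.op ∧
      (∀ R ∈ D, R.op ⊆ P.op ∧ (a * av P) * volume R.op ≤ ∫⁻ x in R.op, f x ∧
        ∫⁻ x in R.op, f x ≤ 2 ^ n * (a * av P) * volume R.op) ∧
      ∀ᵐ x, x ∈ P.op → x ∉ ⋃ R ∈ D, R.op → f x ≤ a * av P := by
    intro P
    refine cz P f hf _ (hfin P) ?_
    rw [mul_assoc, hav]
    exact le_mul_of_one_le_left (zero_le) ha
  choose 𝒞 h𝒞d h𝒞 h𝒞ae using hcz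
  let D : ℕ → Set (RCube n) := fun k => Nat.rec {Q} (fun _ S => ⋃ P ∈ S, 𝒞 P) k
  have hD0 : D 0 = {Q} := rfl
  have hDs : ∀ k, D (k + 1) = ⋃ P ∈ D k, 𝒞 P := fun k => rfl
  have hmem : ∀ k R, R ∈ D (k + 1) ↔ ∃ P ∈ D k, R ∈ 𝒞 P := by
    intro k R; rw [hDs]; simp
  have hdis : ∀ k, (D k).PairwiseDisjoint RCube.op := by
    intro k
    induction k with
    | zero => rw [hD0]; exact pairwiseDisjoint_singleton _ _
    | succ k ih =>
      intro R hR R' hR' hne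
      obtain ⟨P, hP, hRP⟩ := (hmem k R).1 hR
      obtain ⟨P', hP', hRP'⟩ := (hmem k R').1 hR'
      by_cases h : P = P'
      · subst h; exact h𝒞d P hRP hRP' hne
      · exact (ih hP hP' h).mono (h𝒞 P R hRP).1 (h𝒞 P' R' hRP').1
  have hsub : ∀ k, opU (D (k + 1)) ⊆ opU (D k) := by
    intro k x hx
    simp only [opU, mem_iUnion] at hx ⊢
    obtain ⟨R, hR, hx⟩ := hx
    obtain ⟨P, hP, hRP⟩ := (hmem k R).1 hR
    exact ⟨P, hP, (h𝒞 P R hRP).1 hx⟩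
  have hinter : ∀ k, ∀ P ∈ D k, P.op ∩ opU (D (k + 1)) = opU (𝒞 P) := by
    intro k P hP
    ext x
    simp only [opU, mem_inter_iff, mem_iUnion]
    constructor
    · rintro ⟨hx, R, hR, hxR⟩
      obtain ⟨P', hP', hRP⟩ := (hmem k R).1 hR
      have : P' = P := by
        by_contra hne
        exact Set.disjoint_left.1 (hdis k hP' hP hne) ((h𝒞 P' R hRP).1 hxR) hx
      subst this
      exact ⟨R, hRP, hxR⟩
    · rintro ⟨R, hR, hxR⟩
      exact ⟨(h𝒞 P R hR).1 hxR, R, (hmem k R).2 ⟨P, hP, hR⟩, hxR⟩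
  have hbd : ∀ k, ∀ P ∈ D k, av P ≤ (2 ^ n * a) ^ k * av Q := by
    intro k
    induction k with
    | zero => intro P hP; rw [hD0] at hP; simp at hP; simp [hP]
    | succ k ih =>
      intro R hR
      obtain ⟨P, hP, hRP⟩ := (hmem k R).1 hR
      have h1 : av R ≤ 2 ^ n * (a * av P) := ENNReal.div_le_of_le_mul (h𝒞 P R hRP).2.2
      calc av R ≤ 2 ^ n * (a * av P) := h1
        _ ≤ 2 ^ n * (a * ((2 ^ n * a) ^ k * av Q)) := by gcongr; exact ih P hP
        _ = _ := by ring
  refine ⟨D, hD0, hdis, hsub, ?_, ?_, ?_⟩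
  · intro k
    induction k with
    | zero => rw [hD0]; simp [opU]
    | succ k ih => exact (hsub k).trans ih
  · intro k P hP
    rw [hinter k P hP]
    have hcount := disj_countable _ (h𝒞d P)
    have h1 : volume (opU (𝒞 P)) = ∑' R : 𝒞 P, volume R.1.op :=
      measure_biUnion hcount (h𝒞d P) (fun R _ => R.meas_op)
    have h2 : ∫⁻ x in opU (𝒞 P), f x = ∑' R : 𝒞 P, ∫⁻ x in R.1.op, f x :=
      lintegral_biUnion hcount (fun R _ => R.meas_op) (h𝒞d P) f
    have h3 : (a * av P) * volume (opU (𝒞 P)) ≤ ∫⁻ x in P.op, f x := by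
      rw [h1, ← ENNReal.tsum_mul_left]
      calc _ ≤ ∑' R : 𝒞 P, ∫⁻ x in R.1.op, f x :=
            ENNReal.tsum_le_tsum fun R => (h𝒞 P R.1 R.2).2.1
        _ = ∫⁻ x in opU (𝒞 P), f x := h2.symm
        _ ≤ _ := lintegral_mono_set (iUnion₂_subset fun R hR => (h𝒞 P R hR).1)
    rw [← hav P, mul_comm a, mul_assoc] at h3
    exact (ENNReal.mul_le_mul_iff_right (hav0 P) (havt P)).1 h3
  · intro k
    have hall : ∀ᵐ x, ∀ P ∈ D k, x ∈ P.op → x ∉ ⋃ R ∈ 𝒞 P, R.op → f x ≤ a * av P :=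
      (ae_ball_iff (disj_countable _ (hdis k))).2 fun P _ => h𝒞ae P
    filter_upwards [hall] with x hx h1 h2
    simp only [opU, mem_iUnion] at h1
    obtain ⟨P, hP, hxP⟩ := h1
    refine (hx P hP hxP ?_).trans ?_
    · intro h
      apply h2
      have : x ∈ opU (𝒞 P) := h
      rw [← hinter k P hP] at this
      exact this.2
    · gcongr
      exact hbd k P hP

lemma cubeSum_mod {n : ℕ} (p : (Fin n → ℝ) → ℝ) (hpm : Measurable p) (hp1 : ∀ x, 1 ≤ p x)
    {ι : Type} (I : Finset ι) (d : ι → RCube n) (s : ι → ℝ) (A : ι → Set (Fin n → ℝ))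
    (F : Set (RCube n)) (t : RCube n → ℝ) (E : RCube n → Set (Fin n → ℝ))
    (hF : ∀ R, R ∈ F ↔ ∃ i ∈ I, d i = R) (ht : ∀ i ∈ I, t (d i) = s i)
    (hE : ∀ i ∈ I, E (d i) = A i) (hAd : (I : Set ι).PairwiseDisjoint A)
    (hAm : ∀ i ∈ I, MeasurableSet (A i)) (μ : ℝ≥0∞) :
    ∫⁻ x, (cubeSum F t E x / μ) ^ p x
      = ∑ i ∈ I, ∫⁻ x in A i, (ENNReal.ofReal (s i) / μ) ^ p x := by
  have h1 : ∀ i ∈ I, ∫⁻ x in A i, (ENNReal.ofReal (s i) / μ) ^ p x =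
      ∫⁻ x, (A i).indicator (fun x => (ENNReal.ofReal (s i) / μ) ^ p x) x := fun i hi =>
    (lintegral_indicator (hAm i hi) _).symm
  rw [Finset.sum_congr rfl h1, ← lintegral_finsetSum']
  swap
  · intro i hi
    exact ((measurable_const.pow hpm).indicator (hAm i hi)).aemeasurable
  refine lintegral_congr fun x => ?_
  have hp : 0 < p x := lt_of_lt_of_le one_pos (hp1 x)
  by_cases hx : ∃ i ∈ I, x ∈ A i
  · obtain ⟨i, hi, hxi⟩ := hx
    have huniq : ∀ j ∈ I, x ∈ A j → j = i := by
      intro j hj hxj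
      by_contra hne
      exact Set.disjoint_left.1 (hAd hj hi hne) hxj hxi
    have hc : cubeSum F t E x = ENNReal.ofReal (s i) := by
      apply le_antisymm
      · refine iSup_le fun R => iSup_le fun hR => iSup_le fun hxR => ?_
        obtain ⟨j, hj, rfl⟩ := (hF R).1 hR
        rw [hE j hj] at hxR
        rw [ht j hj, huniq j hj hxR]
      · refine le_iSup_of_le (d i) (le_iSup_of_le ((hF _).2 ⟨i, hi, rfl⟩)
          (le_iSup_of_le (by rw [hE i hi]; exact hxi) ?_))
        rw [ht i hi]
    rw [hc, Finset.sum_eq_single i]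
    · rw [indicator_of_mem hxi]
    · intro j hj hne
      exact indicator_of_notMem (fun h => hne (huniq j hj h)) _
    · intro h; exact absurd hi h
  · push Not at hx
    have hc : cubeSum F t E x = 0 := by
      rw [← nonpos_iff_eq_zero]
      refine iSup_le fun R => iSup_le fun hR => iSup_le fun hxR => ?_
      obtain ⟨j, hj, rfl⟩ := (hF R).1 hR
      rw [hE j hj] at hxR
      exact absurd hxR (hx j hj)
    rw [hc, Finset.sum_eq_zero]
    · rw [ENNReal.zero_div, ENNReal.zero_rpow_of_pos hp]
    · intro j hj
      exact indicator_of_notMem (hx j hj) _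

lemma mul_pow_le {c g : ℝ≥0∞} {q B : ℝ} (hc : 1 ≤ c) (hq : 1 ≤ q) (hB : q ≤ B) :
    (c * g) ^ q ≤ c ^ B * g ^ q := by
  rw [ENNReal.mul_rpow_of_nonneg _ _ (by linarith)]
  gcongr

lemma le_mul_pow {c g : ℝ≥0∞} {q : ℝ} (hc : 1 ≤ c) (hq : 1 ≤ q) :
    c * g ^ q ≤ (c * g) ^ q := by
  rw [ENNReal.mul_rpow_of_nonneg _ _ (by linarith)]
  gcongr
  calc c = c ^ (1 : ℝ) := by simp
    _ ≤ _ := by gcongr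

/-- modular version of the condition, disjoint closed cubes -/
lemma ainf_mod0 {n : ℕ} (p : (Fin n → ℝ) → ℝ) (hpm : Measurable p) (hp1 : ∀ x, 1 ≤ p x)
    (B : ℝ) (hB : ∀ x, p x ≤ B) (lam C : ℝ) (hC : 0 < C) (hA : AInftyWith p lam C) :
    ∃ ε : ℝ≥0∞, 0 < ε ∧ ε ≤ 1 / 2 ∧ ∀ {ι : Type} (I : Finset ι) (c : ι → RCube n) (s : ι → ℝ)
      (E : ι → Set (Fin n → ℝ)), (∀ i ∈ I, 0 ≤ s i) →
      (I : Set ι).PairwiseDisjoint (fun i => (c i).toSet) →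
      (∀ i ∈ I, MeasurableSet (E i) ∧ E i ⊆ (c i).toSet ∧
        ENNReal.ofReal lam * volume (c i).toSet ≤ volume (E i)) →
      ∑ i ∈ I, ∫⁻ x in E i, ENNReal.ofReal (s i) ^ p x ≤ ε →
      ∑ i ∈ I, ∫⁻ x in (c i).toSet, ENNReal.ofReal (s i) ^ p x ≤ 1 / 2 := by
  have hB1 : 1 ≤ B := (hp1 0).trans (hB 0)
  set K : ℝ≥0∞ := ENNReal.ofReal (4 * max C 1) with hK
  have hK2 : 2 ≤ K := by
    rw [hK]
    calc (2 : ℝ≥0∞) = ENNReal.ofReal 2 := by simp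
      _ ≤ _ := ENNReal.ofReal_le_ofReal (by have := le_max_right C 1; linarith)
  have hK1 : 1 ≤ K := le_trans (by norm_num) hK2
  have hKt : K ≠ ∞ := ofReal_ne_top
  have hK0 : K ≠ 0 := (lt_of_lt_of_le one_pos hK1).ne'
  have hKB : K ≤ K ^ B := by
    calc K = K ^ (1 : ℝ) := by simp
      _ ≤ _ := by gcongr
  refine ⟨(K ^ B)⁻¹, ?_, ?_, ?_⟩
  · exact ENNReal.inv_pos.2 (ENNReal.rpow_ne_top_of_nonneg (by linarith) hKt)
  · rw [one_div]
    exact ENNReal.inv_le_inv.2 (hK2.trans hKB)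
  intro ι I c s E hs hd hE hsum
  rcases I.eq_empty_or_nonempty with hI | ⟨i0, hi0⟩
  · simp [hI]
  classical
  have : Nonempty ι := ⟨i0⟩
  have hinj : Set.InjOn c I := by
    intro i hi j hj hij
    by_contra hne
    have := hd hi hj hne
    simp only [Function.onFun, hij, disjoint_self] at this
    exact Set.notMem_empty _ (this ▸ (c j).op_subset (c j).center_mem)
  let g := Function.invFunOn c (I : Set ι)
  have hg : ∀ i ∈ I, g (c i) = i := fun i hi => hinj.leftInvOn_invFunOn hi
  let F : Set (RCube n) := c '' I
  have hF : ∀ R, R ∈ F ↔ ∃ i ∈ I, c i = R := fun R => by simp [F]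
  have hmod1 := cubeSum_mod p hpm hp1 I c s E F (s ∘ g) (E ∘ g) hF
    (fun i hi => by simp [hg i hi]) (fun i hi => by simp [hg i hi])
    (fun i hi j hj hne => (hd hi hj hne).mono (hE i hi).2.1 (hE j hj).2.1)
    (fun i hi => (hE i hi).1)
  have hmod2 := cubeSum_mod p hpm hp1 I c s (fun i => (c i).toSet) F (s ∘ g) RCube.toSet hF
    (fun i hi => by simp [hg i hi]) (fun i hi => rfl) hd
    (fun i hi => (c i).meas_toSet)
  have hAF := hA F
    (by
      rintro R hR R' hR' hne
      obtain ⟨i, hi, rfl⟩ := (hF _).1 hR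
      obtain ⟨j, hj, rfl⟩ := (hF _).1 hR'
      exact hd hi hj (fun h => hne (by rw [h])))
    (s ∘ g)
    (by
      intro R hR
      obtain ⟨i, hi, rfl⟩ := (hF _).1 hR
      simpa [hg i hi] using hs i hi)
    (E ∘ g)
    (by
      intro R hR
      obtain ⟨i, hi, rfl⟩ := (hF _).1 hR
      simpa [hg i hi] using hE i hi)
  have hsmall : vnorm p (cubeSum F (s ∘ g) (E ∘ g)) ≤ K⁻¹ := by
    apply sInf_le
    refine ⟨ENNReal.inv_pos.2 hKt, ?_⟩
    rw [hmod1]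
    calc _ ≤ ∑ i ∈ I, ∫⁻ x in E i, K ^ B * ENNReal.ofReal (s i) ^ p x := by
          refine Finset.sum_le_sum fun i _ => lintegral_mono fun x => ?_
          rw [div_eq_mul_inv, inv_inv, mul_comm]
          exact mul_pow_le hK1 (hp1 x) (hB x)
      _ = K ^ B * ∑ i ∈ I, ∫⁻ x in E i, ENNReal.ofReal (s i) ^ p x := by
          rw [Finset.mul_sum]
          refine Finset.sum_congr rfl fun i _ => ?_
          rw [lintegral_const_mul _ (measurable_const.pow hpm)]
      _ ≤ K ^ B * (K ^ B)⁻¹ := by gcongr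
      _ ≤ 1 := ENNReal.mul_inv_le_one _
  have hbig : vnorm p (cubeSum F (s ∘ g) RCube.toSet) < 1 / 2 := by
    calc _ ≤ ENNReal.ofReal C * K⁻¹ := hAF.trans (by gcongr)
      _ ≤ ENNReal.ofReal (1 / 4) := by
          rw [hK, ← ENNReal.ofReal_inv_of_pos (by positivity), ← ENNReal.ofReal_mul hC.le]
          apply ENNReal.ofReal_le_ofReal
          rw [← div_eq_mul_inv, div_le_iff₀ (by positivity)]
          have := le_max_left C 1
          linarith
      _ < ENNReal.ofReal (1 / 2) := by
          rw [ENNReal.ofReal_lt_ofReal_iff (by norm_num)]; norm_num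
      _ = 1 / 2 := by
          rw [ENNReal.ofReal_div_of_pos (by norm_num)]; simp
  obtain ⟨μ, ⟨hμ0, hμ⟩, hμ2⟩ := sInf_lt_iff.1 hbig
  rw [hmod2] at hμ
  have h2μ : (2 : ℝ≥0∞) ≤ μ⁻¹ := by
    rw [ENNReal.le_inv_iff_le_inv, ← one_div]; exact hμ2.le
  have h3 : 2 * ∑ i ∈ I, ∫⁻ x in (c i).toSet, ENNReal.ofReal (s i) ^ p x ≤ 1 := by
    refine le_trans ?_ hμ
    rw [Finset.mul_sum]
    refine Finset.sum_le_sum fun i _ => ?_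
    rw [← lintegral_const_mul _ (measurable_const.pow hpm)]
    refine lintegral_mono fun x => ?_
    refine (le_mul_pow (by norm_num) (hp1 x)).trans ?_
    have := hp1 x
    rw [div_eq_mul_inv, mul_comm]
    gcongr
  rw [ENNReal.le_div_iff_mul_le (by simp) (by simp), mul_comm]
  exact h3

/-- shrunk cube -/
def shr {n : ℕ} (k : ℕ) (Q : RCube n) : RCube n where
  center := Q.center
  side := (1 - 1 / ((k : ℝ) + 2)) * Q.side
  side_pos := by
    have := Q.side_pos
    have h : 1 / ((k : ℝ) + 2) < 1 := by
      rw [div_lt_one (by positivity)]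
      have : (0 : ℝ) ≤ k := by positivity
      linarith
    have : 0 < 1 - 1 / ((k : ℝ) + 2) := by linarith
    positivity

lemma shr_subset {n : ℕ} (k : ℕ) (Q : RCube n) : (shr k Q).toSet ⊆ Q.op := by
  rw [RCube.toSet_eq, RCube.op]
  apply Metric.closedBall_subset_ball
  have := Q.side_pos
  have h : 0 < 1 / ((k : ℝ) + 2) := by positivity
  simp only [shr]
  nlinarith

lemma shr_mono {n : ℕ} (Q : RCube n) : Monotone fun k => (shr k Q).toSet := by
  intro k l hkl
  simp only [RCube.toSet_eq]
  apply Metric.closedBall_subset_closedBall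
  have := Q.side_pos
  simp only [shr]
  have h : 1 / ((l : ℝ) + 2) ≤ 1 / ((k : ℝ) + 2) := by
    apply one_div_le_one_div_of_le (by positivity)
    have : (k : ℝ) ≤ l := by exact_mod_cast hkl
    linarith
  nlinarith

lemma shr_tendsto : Filter.Tendsto (fun k : ℕ => 1 - 1 / ((k : ℝ) + 2)) Filter.atTop (nhds 1) := by
  have h : Filter.Tendsto (fun k : ℕ => 1 / ((k : ℝ) + 2)) Filter.atTop (nhds 0) := by
    have := (tendsto_one_div_add_atTop_nhds_zero_nat (𝕜 := ℝ)).comp (Filter.tendsto_add_atTop_nat 1)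
    refine this.congr fun k => ?_
    simp only [Function.comp]
    push_cast
    ring
  simpa using h.const_sub 1

lemma shr_iUnion {n : ℕ} (Q : RCube n) : ⋃ k, (shr k Q).toSet = Q.op := by
  apply Subset.antisymm
  · exact iUnion_subset fun k => shr_subset k Q
  · intro x hx
    rw [RCube.op, Metric.mem_ball] at hx
    have h := (shr_tendsto.mul_const (Q.side / 2))
    rw [one_mul] at h
    obtain ⟨k, hk⟩ := (h.eventually (lt_mem_nhds hx)).exists
    rw [mem_iUnion]
    refine ⟨k, ?_⟩
    rw [RCube.toSet_eq, Metric.mem_closedBall]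
    simp only [shr]
    linarith

lemma shr_lint {n : ℕ} (Q : RCube n) (f : (Fin n → ℝ) → ℝ≥0∞) :
    Filter.Tendsto (fun k => ∫⁻ x in (shr k Q).toSet, f x) Filter.atTop
      (nhds (∫⁻ x in Q.op, f x)) := by
  rw [← shr_iUnion, setLIntegral_iUnion_of_directed f (shr_mono Q).directed_le]
  exact tendsto_atTop_iSup fun k l h => lintegral_mono_set (shr_mono Q h)

/-- modular version of the condition, open cubes -/
lemma ainf_mod {n : ℕ} (p : (Fin n → ℝ) → ℝ) (hpm : Measurable p) (hp1 : ∀ x, 1 ≤ p x)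
    (B : ℝ) (hB : ∀ x, p x ≤ B) (hA : AInfty p) :
    ∃ lam : ℝ, 0 < lam ∧ lam < 1 ∧
    ∃ ε : ℝ≥0∞, 0 < ε ∧ ε ≤ 1 / 2 ∧ ∀ {ι : Type} (I : Finset ι) (c : ι → RCube n) (s : ι → ℝ)
      (E : ι → Set (Fin n → ℝ)), (∀ i ∈ I, 0 ≤ s i) →
      (I : Set ι).PairwiseDisjoint (fun i => (c i).op) →
      (∀ i ∈ I, MeasurableSet (E i) ∧ E i ⊆ (c i).op ∧
        ENNReal.ofReal lam * volume (c i).op ≤ volume (E i)) →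
      ∑ i ∈ I, ∫⁻ x in E i, ENNReal.ofReal (s i) ^ p x ≤ ε →
      ∑ i ∈ I, ∫⁻ x in (c i).op, ENNReal.ofReal (s i) ^ p x ≤ 1 / 2 := by
  obtain ⟨lam, ⟨hl0, hl1⟩, C, hC, hA⟩ := hA
  obtain ⟨ε, hε0, hε, H⟩ := ainf_mod0 p hpm hp1 B hB lam C hC hA
  refine ⟨(1 + lam) / 2, by linarith, by linarith, ε, hε0, hε, ?_⟩
  intro ι I c s E hs hd hE hsum
  have hlim : Filter.Tendsto
      (fun k => ∑ i ∈ I, ∫⁻ x in (shr k (c i)).toSet, ENNReal.ofReal (s i) ^ p x) Filter.atTop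
      (nhds (∑ i ∈ I, ∫⁻ x in (c i).op, ENNReal.ofReal (s i) ^ p x)) :=
    tendsto_finsetSum _ fun i _ => shr_lint (c i) _
  refine le_of_tendsto hlim ?_
  have hq := shr_tendsto.pow n
  rw [one_pow] at hq
  have hev := hq.eventually (lt_mem_nhds (show 1 - (1 - lam) / 2 < 1 by linarith))
  filter_upwards [hev] with k hk
  refine H I (fun i => shr k (c i)) s (fun i => E i ∩ (shr k (c i)).toSet) hs ?_ ?_ ?_
  · intro i hi j hj hne
    exact (hd hi hj hne).mono (shr_subset _ _) (shr_subset _ _)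
  · intro i hi
    obtain ⟨hEm, hEs, hEv⟩ := hE i hi
    refine ⟨hEm.inter (RCube.meas_toSet _), inter_subset_right, ?_⟩
    set q := 1 - 1 / ((k : ℝ) + 2) with hqd
    have hq0 : 0 ≤ q := by
      rw [hqd, sub_nonneg, div_le_one (by positivity)]
      have : (0 : ℝ) ≤ k := by positivity
      linarith
    have hq1 : q ≤ 1 := by
      have : 0 < 1 / ((k : ℝ) + 2) := by positivity
      linarith
    have hqn0 : 0 ≤ q ^ n := pow_nonneg hq0 n
    have hqn1 : q ^ n ≤ 1 := pow_le_one₀ hq0 hq1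
    set w := (c i).side ^ n with hw
    have hw0 : 0 < w := by have := (c i).side_pos; positivity
    have hS : volume (shr k (c i)).toSet = ENNReal.ofReal (q ^ n * w) := by
      rw [RCube.vol_toSet]; simp only [shr]; rw [mul_pow]
    have hdiff : volume ((c i).op \ (shr k (c i)).toSet) = ENNReal.ofReal ((1 - q ^ n) * w) := by
      rw [measure_diff (shr_subset _ _) (RCube.meas_toSet _).nullMeasurableSet (by rw [hS]; simp), hS,
        RCube.vol_op, ← ENNReal.ofReal_sub _ (by positivity)]
      congr 1; ring
    have h1 : volume (E i) ≤ volume (E i ∩ (shr k (c i)).toSet)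
        + ENNReal.ofReal ((1 - q ^ n) * w) := by
      rw [← hdiff, ← measure_inter_add_diff (E i) (RCube.meas_toSet (shr k (c i)))]
      gcongr
    have h2 := hEv.trans h1
    rw [RCube.vol_op, ← ENNReal.ofReal_mul (by linarith)] at h2
    have h3 : ENNReal.ofReal (lam * w) + ENNReal.ofReal ((1 - q ^ n) * w)
        ≤ ENNReal.ofReal ((1 + lam) / 2 * w) := by
      rw [← ENNReal.ofReal_add (by positivity) (mul_nonneg (by linarith) hw0.le)]
      apply ENNReal.ofReal_le_ofReal
      nlinarith
    have h4 := (ENNReal.add_le_add_iff_right ofReal_ne_top).1 (h3.trans h2)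
    refine le_trans ?_ h4
    rw [hS, ← ENNReal.ofReal_mul hl0.le]
    apply ENNReal.ofReal_le_ofReal
    apply mul_le_mul_of_nonneg_left _ hl0.le
    nlinarith
  · refine le_trans (Finset.sum_le_sum fun i _ => ?_) hsum
    exact lintegral_mono_set inter_subset_left

lemma lint_opU {n : ℕ} (D : Set (RCube n)) (hD : D.PairwiseDisjoint RCube.op)
    (U : Set (Fin n → ℝ)) (hU : MeasurableSet U) (g : (Fin n → ℝ) → ℝ≥0∞) :
    ∫⁻ x in opU D \ U, g x = ∑' P : D, ∫⁻ x in P.1.op \ U, g x := by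
  have : Countable D := (disj_countable D hD).to_subtype
  rw [← lintegral_iUnion]
  · congr 2
    ext x
    simp only [opU, mem_sdiff, mem_iUnion, Subtype.exists, exists_prop]
    constructor
    · rintro ⟨⟨R, hR, hx⟩, h⟩; exact ⟨R, hR, hx, h⟩
    · rintro ⟨R, hR, hx, h⟩; exact ⟨⟨R, hR, hx⟩, h⟩
  · intro P; exact P.1.meas_op.diff hU
  · intro P R h
    have : Disjoint P.1.op R.1.op := hD P.2 R.2 (fun e => h (Subtype.ext e))
    exact this.mono sdiff_subset sdiff_subset

lemma decay_step {n : ℕ} (p : (Fin n → ℝ) → ℝ) (lam : ℝ) (hl0 : 0 < lam) (hl1 : lam < 1)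
    (ε : ℝ≥0∞) (hε : ε ≤ 1 / 2)
    (H : ∀ {ι : Type} (I : Finset ι) (c : ι → RCube n) (s : ι → ℝ)
      (E : ι → Set (Fin n → ℝ)), (∀ i ∈ I, 0 ≤ s i) →
      (I : Set ι).PairwiseDisjoint (fun i => (c i).op) →
      (∀ i ∈ I, MeasurableSet (E i) ∧ E i ⊆ (c i).op ∧
        ENNReal.ofReal lam * volume (c i).op ≤ volume (E i)) →
      ∑ i ∈ I, ∫⁻ x in E i, ENNReal.ofReal (s i) ^ p x ≤ ε →
      ∑ i ∈ I, ∫⁻ x in (c i).op, ENNReal.ofReal (s i) ^ p x ≤ 1 / 2)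
    (S : Finset (RCube n)) (hS : (S : Set (RCube n)).PairwiseDisjoint RCube.op)
    (s : RCube n → ℝ) (hs : ∀ Q ∈ S, 0 ≤ s Q) (D : RCube n → Set (RCube n))
    (U : RCube n → Set (Fin n → ℝ)) (hUm : ∀ Q, MeasurableSet (U Q))
    (hD : ∀ Q ∈ S, (D Q).PairwiseDisjoint RCube.op) (hDQ : ∀ Q ∈ S, opU (D Q) ⊆ Q.op)
    (hU : ∀ Q ∈ S, U Q ⊆ opU (D Q))
    (hvol : ∀ Q ∈ S, ∀ P ∈ D Q,
      ENNReal.ofReal (1 / (1 - lam)) * volume (P.op ∩ U Q) ≤ volume P.op)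
    (hsum : ∑ Q ∈ S, ∫⁻ x in opU (D Q), ENNReal.ofReal (s Q) ^ p x ≤ 1) :
    ∑ Q ∈ S, ∫⁻ x in U Q, ENNReal.ofReal (s Q) ^ p x ≤ 1 - ε := by
  have hεt : ε ≠ ∞ := ne_top_of_le_ne_top (by simp) hε
  have hsplit : ∑ Q ∈ S, ∫⁻ x in opU (D Q), ENNReal.ofReal (s Q) ^ p x
      = (∑ Q ∈ S, ∫⁻ x in U Q, ENNReal.ofReal (s Q) ^ p x)
        + ∑ Q ∈ S, ∫⁻ x in opU (D Q) \ U Q, ENNReal.ofReal (s Q) ^ p x := by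
    rw [← Finset.sum_add_distrib]
    refine Finset.sum_congr rfl fun Q hQ => ?_
    rw [← lintegral_inter_add_sdiff _ (opU (D Q)) (hUm Q),
      inter_eq_self_of_subset_right (hU Q hQ)]
  by_cases h : ∑ Q ∈ S, ∫⁻ x in opU (D Q) \ U Q, ENNReal.ofReal (s Q) ^ p x ≤ ε
  · have key : ∑ Q ∈ S, ∫⁻ x in opU (D Q), ENNReal.ofReal (s Q) ^ p x ≤ 1 / 2 := by
      have e0 : ∀ V : RCube n → Set (Fin n → ℝ), (∀ Q, MeasurableSet (V Q)) →
          ∑ Q ∈ S, ∫⁻ x in opU (D Q) \ V Q, ENNReal.ofReal (s Q) ^ p x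
          = ∑' i : (Σ q : {q // q ∈ S}, ↥(D q.1)),
            ∫⁻ x in i.2.1.op \ V i.1.1, ENNReal.ofReal (s i.1.1) ^ p x := by
        intro V hV
        rw [ENNReal.tsum_sigma', tsum_fintype, ← Finset.sum_coe_sort]
        refine Finset.sum_congr rfl fun q _ => ?_
        exact lint_opU _ (hD q.1 q.2) _ (hV _) _
      have e1 := e0 (fun _ => ∅) (fun _ => MeasurableSet.empty)
      simp only [sdiff_empty] at e1
      rw [e1, ENNReal.tsum_eq_iSup_sum]
      refine iSup_le fun I => ?_
      apply H I (fun i => i.2.1) (fun i => s i.1.1) (fun i => i.2.1.op \ U i.1.1)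
      · intro i _; exact hs _ i.1.2
      · rintro ⟨q, P⟩ _ ⟨q', P'⟩ _ hne
        by_cases hq : q = q'
        · subst hq
          exact hD q.1 q.2 P.2 P'.2 (fun e => hne (by rw [Subtype.ext e]))
        · have := hS q.2 q'.2 (fun e => hq (Subtype.ext e))
          refine Disjoint.mono ?_ ?_ this
          · exact (subset_biUnion_of_mem (u := RCube.op) P.2).trans (hDQ q.1 q.2)
          · exact (subset_biUnion_of_mem (u := RCube.op) P'.2).trans (hDQ q'.1 q'.2)
      · intro i _
        refine ⟨i.2.1.meas_op.diff (hUm _), sdiff_subset, ?_⟩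
        have h1 := hvol i.1.1 i.1.2 i.2.1 i.2.2
        have h2 := measure_inter_add_sdiff (μ := volume) i.2.1.op (hUm i.1.1)
        have hl : ENNReal.ofReal (1 - lam) * ENNReal.ofReal (1 / (1 - lam)) = 1 := by
          rw [← ENNReal.ofReal_mul (by linarith), mul_one_div_cancel (by linarith)]; simp
        have h3 : volume (i.2.1.op ∩ U i.1.1) ≤ ENNReal.ofReal (1 - lam) * volume i.2.1.op := by
          calc _ = ENNReal.ofReal (1 - lam) *
                (ENNReal.ofReal (1 / (1 - lam)) * volume (i.2.1.op ∩ U i.1.1)) := by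
                rw [← mul_assoc, hl, one_mul]
            _ ≤ _ := by gcongr
        have h4 : ENNReal.ofReal (1 - lam) * volume i.2.1.op + ENNReal.ofReal lam * volume i.2.1.op
            = volume i.2.1.op := by
          rw [← add_mul, ← ENNReal.ofReal_add (by linarith) hl0.le]; simp
        have h5 : ENNReal.ofReal (1 - lam) * volume i.2.1.op + ENNReal.ofReal lam * volume i.2.1.op
          ≤ ENNReal.ofReal (1 - lam) * volume i.2.1.op + volume (i.2.1.op \ U i.1.1) := by
          rw [h4]
          conv_lhs => rw [← h2]
          gcongr
        exact (ENNReal.add_le_add_iff_left (ENNReal.mul_ne_top ofReal_ne_top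
          (RCube.vol_ne_top _))).1 h5
      · refine le_trans (ENNReal.sum_le_tsum _) ?_
        rw [← e0 U hUm]
        exact h
    calc _ ≤ ∑ Q ∈ S, ∫⁻ x in opU (D Q), ENNReal.ofReal (s Q) ^ p x := by
          rw [hsplit]; exact le_self_add
      _ ≤ 1 / 2 := key
      _ ≤ 1 - ε := by
          apply ENNReal.le_sub_of_add_le_right hεt
          calc _ ≤ (1 / 2 + 1 / 2 : ℝ≥0∞) := by gcongr
            _ = 1 := ENNReal.add_halves 1
  · push Not at h
    apply ENNReal.le_sub_of_add_le_right hεt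
    calc _ ≤ _ := add_le_add_right h.le _
      _ = _ := hsplit.symm
      _ ≤ 1 := hsum

lemma decay {n : ℕ} (p : (Fin n → ℝ) → ℝ) (hpm : Measurable p) (hp1 : ∀ x, 1 ≤ p x)
    (B : ℝ) (hB : ∀ x, p x ≤ B) (hA : AInfty p) :
    ∃ a : ℝ≥0∞, 1 ≤ a ∧ a ≠ ∞ ∧ ∃ η : ℝ≥0∞, η < 1 ∧
      ∀ (S : Finset (RCube n)), (S : Set (RCube n)).PairwiseDisjoint RCube.op →
      ∀ (t : RCube n → ℝ), (∀ Q ∈ S, 0 < t Q) →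
      ∀ (D : RCube n → ℕ → Set (RCube n)),
      (∀ Q ∈ S, D Q 0 = {Q} ∧ (∀ k, (D Q k).PairwiseDisjoint RCube.op) ∧
      (∀ k, opU (D Q (k + 1)) ⊆ opU (D Q k)) ∧
      (∀ k, opU (D Q k) ⊆ Q.op) ∧
      (∀ k, ∀ P ∈ D Q k, a * volume (P.op ∩ opU (D Q (k + 1))) ≤ volume P.op)) →
      ∑ Q ∈ S, ∫⁻ x in Q.op, ENNReal.ofReal (t Q) ^ p x ≤ 1 →
      ∀ k, ∑ Q ∈ S, ∫⁻ x in opU (D Q k), ENNReal.ofReal (t Q) ^ p x ≤ η ^ k := by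
  obtain ⟨lam, hl0, hl1, ε, hε0, hε, H⟩ := ainf_mod p hpm hp1 B hB hA
  have hB1 : 1 ≤ B := (hp1 0).trans (hB 0)
  have hB0 : 0 < B := by linarith
  have hεt : ε ≠ ∞ := ne_top_of_le_ne_top (by simp) hε
  refine ⟨ENNReal.ofReal (1 / (1 - lam)), ?_, ofReal_ne_top, (1 - ε) ^ (1 / B), ?_, ?_⟩
  · rw [← ENNReal.ofReal_one]
    apply ENNReal.ofReal_le_ofReal
    rw [le_div_iff₀ (by linarith)]; linarith
  · apply ENNReal.rpow_lt_one _ (by positivity)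
    exact ENNReal.sub_lt_self (by simp) (by simp) hε0.ne'
  intro S hS t ht D hD hsum
  set η : ℝ≥0∞ := (1 - ε) ^ (1 / B) with hη
  have h1ε : (1 : ℝ≥0∞) - ε ≠ 0 := by
    rw [Ne, tsub_eq_zero_iff_le, not_le]
    refine lt_of_le_of_lt hε ?_
    simp
  have hη1 : η ≤ 1 := ENNReal.rpow_le_one tsub_le_self (by positivity)
  have hη0 : η ≠ 0 := by
    rw [hη, Ne, ENNReal.rpow_eq_zero_iff]
    simp [h1ε, hB0.le]
  have hηt : η ≠ ∞ := ne_top_of_le_ne_top one_ne_top hη1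
  have hηB : η ^ B = 1 - ε := by
    rw [hη, ← ENNReal.rpow_mul, one_div_mul_cancel hB0.ne', ENNReal.rpow_one]
  -- real version
  set e : ℝ := η.toReal with he
  have he0 : 0 < e := ENNReal.toReal_pos hη0 hηt
  have hee : ENNReal.ofReal e = η := ENNReal.ofReal_toReal hηt
  have claim : ∀ k, ∑ Q ∈ S, ∫⁻ x in opU (D Q k), ENNReal.ofReal (t Q * (e⁻¹) ^ k) ^ p x ≤ 1 := by
    intro k
    induction k with
    | zero =>
      refine le_trans (le_of_eq ?_) hsum
      refine Finset.sum_congr rfl fun Q hQ => ?_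
      rw [(hD Q hQ).1]; simp [opU]
    | succ k ih =>
      have st := decay_step p lam hl0 hl1 ε hε H S hS (fun Q => t Q * (e⁻¹) ^ k)
        (fun Q hQ => by have := ht Q hQ; positivity) (fun Q => D Q k) (fun Q => opU (D Q (k + 1)))
        (fun Q => opU_meas _) (fun Q hQ => (hD Q hQ).2.1 k) (fun Q hQ => (hD Q hQ).2.2.2.1 k)
        (fun Q hQ => (hD Q hQ).2.2.1 k) (fun Q hQ => (hD Q hQ).2.2.2.2 k) ih
      have hc : (1 : ℝ≥0∞) ≤ η⁻¹ := ENNReal.one_le_inv.2 hη1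
      calc _ ≤ ∑ Q ∈ S, ∫⁻ x in opU (D Q (k + 1)),
              η⁻¹ ^ B * ENNReal.ofReal (t Q * (e⁻¹) ^ k) ^ p x := by
            refine Finset.sum_le_sum fun Q hQ => lintegral_mono fun x => ?_
            refine le_trans (le_of_eq ?_) (mul_pow_le hc (hp1 x) (hB x))
            congr 1
            rw [← hee, ← ENNReal.ofReal_inv_of_pos he0, ← ENNReal.ofReal_mul (by positivity)]
            congr 1; ring
        _ = η⁻¹ ^ B * ∑ Q ∈ S, ∫⁻ x in opU (D Q (k + 1)),
              ENNReal.ofReal (t Q * (e⁻¹) ^ k) ^ p x := by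
            rw [Finset.mul_sum]
            refine Finset.sum_congr rfl fun Q hQ => ?_
            rw [lintegral_const_mul]
            exact measurable_const.pow hpm
        _ ≤ η⁻¹ ^ B * (1 - ε) := by gcongr
        _ = 1 := by
            rw [ENNReal.inv_rpow, hηB, ENNReal.inv_mul_cancel h1ε (by simp)]
  intro k
  have hc : (1 : ℝ≥0∞) ≤ (η⁻¹) ^ k := one_le_pow₀ (ENNReal.one_le_inv.2 hη1)
  have hk : η ^ k * (η⁻¹) ^ k = 1 := by
    rw [← mul_pow, ENNReal.mul_inv_cancel hη0 hηt, one_pow]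
  calc _ = η ^ k * ∑ Q ∈ S, ∫⁻ x in opU (D Q k), (η⁻¹) ^ k * ENNReal.ofReal (t Q) ^ p x := by
        rw [Finset.mul_sum]
        refine Finset.sum_congr rfl fun Q hQ => ?_
        rw [lintegral_const_mul _ (measurable_const.pow hpm), ← mul_assoc, hk, one_mul]
    _ ≤ η ^ k * ∑ Q ∈ S, ∫⁻ x in opU (D Q k), ENNReal.ofReal (t Q * (e⁻¹) ^ k) ^ p x := by
        gcongr with Q hQ x
        refine (le_mul_pow hc (hp1 x)).trans (le_of_eq ?_)
        congr 1
        rw [← hee, ← ENNReal.ofReal_inv_of_pos he0, ← ENNReal.ofReal_pow (by positivity),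
          ← ENNReal.ofReal_mul (by positivity)]
        congr 1; ring
    _ ≤ η ^ k * 1 := by gcongr; exact claim k
    _ = η ^ k := mul_one _

lemma rpow_split (x : ℝ≥0∞) (r : ℝ) (hr : 1 < r) : x ^ r = x ^ (r - 1) * x := by
  conv_rhs => rw [← ENNReal.rpow_one x, ← ENNReal.rpow_mul, one_mul]
  rw [← ENNReal.rpow_add_of_nonneg _ _ (by linarith) (by norm_num)]
  congr 1; ring

lemma rh_one {n : ℕ} (f : (Fin n → ℝ) → ℝ≥0∞) (hf : Measurable f) (M : ℝ≥0∞) (hM : M ≠ ∞)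
    (hfM : ∀ x, f x ≤ M) (Ω : ℕ → Set (Fin n → ℝ)) (hΩ : ∀ k, MeasurableSet (Ω k))
    (hmono : ∀ k, Ω (k + 1) ⊆ Ω k) (r : ℝ) (hr : 1 < r) (β : ℕ → ℝ≥0∞)
    (hβ : ∀ k, ∀ᵐ x, x ∈ Ω k → x ∉ Ω (k + 1) → f x ≤ β k)
    (hlim : Filter.Tendsto (fun k => ∫⁻ x in Ω k, f x) Filter.atTop (nhds 0)) :
    ∫⁻ x in Ω 0, f x ^ r ≤ ∑' k, β k ^ (r - 1) * ∫⁻ x in Ω k, f x := by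
  have h1 : ∀ K, ∫⁻ x in Ω 0, f x ^ r ≤
      (∑ k ∈ Finset.range K, β k ^ (r - 1) * ∫⁻ x in Ω k, f x) + ∫⁻ x in Ω K, f x ^ r := by
    intro K
    induction K with
    | zero => simp
    | succ K ih =>
      refine ih.trans ?_
      rw [Finset.sum_range_succ, add_assoc]
      gcongr
      rw [← lintegral_inter_add_sdiff _ (Ω K) (hΩ (K + 1)),
        inter_eq_self_of_subset_right (hmono K), add_comm]
      gcongr
      rw [← lintegral_const_mul _ hf]
      refine le_trans ?_ (lintegral_mono_set (sdiff_subset (s := Ω K) (t := Ω (K + 1))))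
      refine lintegral_mono_ae ?_
      rw [ae_restrict_iff' ((hΩ K).diff (hΩ (K + 1)))]
      filter_upwards [hβ K] with x hx hx2
      rw [rpow_split _ r hr]
      have := hx hx2.1 hx2.2
      gcongr
  have h2 : ∀ K, ∫⁻ x in Ω 0, f x ^ r ≤
      (∑' k, β k ^ (r - 1) * ∫⁻ x in Ω k, f x) + M ^ (r - 1) * ∫⁻ x in Ω K, f x := by
    intro K
    refine (h1 K).trans (add_le_add (ENNReal.sum_le_tsum _) ?_)
    rw [← lintegral_const_mul _ hf]
    refine lintegral_mono fun x => ?_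
    rw [rpow_split _ r hr]
    have := hfM x
    gcongr
  have h3 : Filter.Tendsto (fun K => (∑' k, β k ^ (r - 1) * ∫⁻ x in Ω k, f x)
      + M ^ (r - 1) * ∫⁻ x in Ω K, f x) Filter.atTop
      (nhds ((∑' k, β k ^ (r - 1) * ∫⁻ x in Ω k, f x) + M ^ (r - 1) * 0)) := by
    refine tendsto_const_nhds.add (ENNReal.Tendsto.const_mul hlim (Or.inr ?_))
    exact ENNReal.rpow_ne_top_of_nonneg (by linarith) hM
  have := ge_of_tendsto' h3 h2
  simpa using this

lemma rh_norm (V m0 X J : ℝ≥0∞) (hV0 : V ≠ 0) (hVt : V ≠ ∞) (r : ℝ) (hr : 1 < r)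
    (h : J ≤ (m0 / V) ^ (r - 1) * X) : V * (J / V) ^ (1 / r) ≤ m0 + X := by
  have h1 : J / V ≤ ((m0 + X) / V) ^ r := by
    calc J / V ≤ ((m0 / V) ^ (r - 1) * X) / V := by gcongr
      _ ≤ (((m0 + X) / V) ^ (r - 1) * (m0 + X)) / V := by
          have : r - 1 ≥ 0 := by linarith
          gcongr
          · exact le_self_add
          · exact le_add_self
      _ = _ := by rw [rpow_split _ r hr, mul_div_assoc]
  calc V * (J / V) ^ (1 / r) ≤ V * (((m0 + X) / V) ^ r) ^ (1 / r) := by gcongr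
    _ = V * ((m0 + X) / V) := by
        rw [← ENNReal.rpow_mul, mul_one_div_cancel (by linarith), ENNReal.rpow_one]
    _ = _ := ENNReal.mul_div_cancel hV0 hVt

lemma exists_r (c η : ℝ≥0∞) (hc : c ≠ ∞) (hη : η < 1) : ∃ r : ℝ, 1 < r ∧ c ^ (r - 1) * η < 1 := by
  have h := ENNReal.Tendsto.const_mul (a := c)
    (ENNReal.tendsto_pow_atTop_nhds_zero_of_lt_one hη) (Or.inr hc)
  rw [mul_zero] at h
  obtain ⟨m, hm, hm1⟩ := ((h.eventually (gt_mem_nhds one_pos)).and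
    (Filter.eventually_ge_atTop 1)).exists
  have hm0 : (0 : ℝ) < m := by exact_mod_cast hm1
  refine ⟨1 + 1 / m, by simpa using hm0, ?_⟩
  have h2 := ENNReal.rpow_lt_one hm (z := 1 / (m : ℝ)) (by positivity)
  rw [ENNReal.mul_rpow_of_nonneg _ _ (by positivity), ← ENNReal.rpow_natCast, ← ENNReal.rpow_mul,
    mul_one_div_cancel hm0.ne', ENNReal.rpow_one] at h2
  simpa using h2

/-- modular -/
def phi {n : ℕ} (p : (Fin n → ℝ) → ℝ) (Q : RCube n) (t : ℝ) : ℝ≥0∞ :=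
  ∫⁻ x in Q.op, ENNReal.ofReal t ^ p x

/-- reverse Hölder functional -/
def psi {n : ℕ} (p : (Fin n → ℝ) → ℝ) (r : ℝ) (Q : RCube n) (t : ℝ) : ℝ≥0∞ :=
  volume Q.op * ((∫⁻ x in Q.op, ENNReal.ofReal t ^ (r * p x)) / volume Q.op) ^ (1 / r)

lemma pow_bdd (t B q : ℝ) (hq : 1 ≤ q) (hB : q ≤ B) :
    ENNReal.ofReal t ^ q ≤ (max 1 (ENNReal.ofReal t)) ^ B := by
  calc _ ≤ (max 1 (ENNReal.ofReal t)) ^ q := by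
        gcongr
        exact le_max_right _ _
    _ ≤ _ := ENNReal.rpow_le_rpow_of_exponent_le (le_max_left _ _) hB

lemma bdd_ne_top (t B : ℝ) (hB : 1 ≤ B) : (max 1 (ENNReal.ofReal t)) ^ B ≠ ∞ := by
  apply ENNReal.rpow_ne_top_of_nonneg (by linarith)
  exact (max_lt one_lt_top ofReal_lt_top).ne

lemma phi_pos {n : ℕ} (p : (Fin n → ℝ) → ℝ) (hpm : Measurable p)
    (Q : RCube n) (t : ℝ) (ht : 0 < t) : phi p Q t ≠ 0 := by
  have hm : Measurable fun x => ENNReal.ofReal t ^ p x := measurable_const.pow hpm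
  rw [phi, Ne, setLIntegral_eq_zero_iff Q.meas_op hm]
  intro h
  have h2 : volume Q.op = 0 := by
    refine measure_mono_null ?_ h
    intro x hx
    simp only [mem_compl_iff, mem_ofPred_eq]
    intro hh
    have := hh hx
    exact (ENNReal.rpow_pos (ENNReal.ofReal_pos.2 ht) ofReal_ne_top).ne' this
  exact Q.vol_ne_zero h2

lemma phi_fin {n : ℕ} (p : (Fin n → ℝ) → ℝ) (hp1 : ∀ x, 1 ≤ p x)
    (B : ℝ) (hB : ∀ x, p x ≤ B) (Q : RCube n) (t : ℝ) : phi p Q t ≠ ∞ := by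
  refine ne_top_of_le_ne_top ?_ (lintegral_mono (fun x => pow_bdd t B (p x) (hp1 x) (hB x)))
  rw [lintegral_const]
  refine ENNReal.mul_ne_top (bdd_ne_top t B ((hp1 0).trans (hB 0))) ?_
  simpa using Q.vol_ne_top

lemma rh {n : ℕ} (p : (Fin n → ℝ) → ℝ) (hpm : Measurable p) (hp1 : ∀ x, 1 ≤ p x)
    (B : ℝ) (hB : ∀ x, p x ≤ B) (hA : AInfty p) :
    ∃ r : ℝ, 1 < r ∧ ∃ C : ℝ≥0∞, 1 ≤ C ∧ C ≠ ∞ ∧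
      ∀ (S : Finset (RCube n)), (S : Set (RCube n)).PairwiseDisjoint RCube.op →
      ∀ (t : RCube n → ℝ), (∀ Q ∈ S, 0 < t Q) →
      ∑ Q ∈ S, phi p Q (t Q) ≤ 1 → ∑ Q ∈ S, psi p r Q (t Q) ≤ C := by
  obtain ⟨a, ha, hat, η, hη, H⟩ := decay p hpm hp1 B hB hA
  set c : ℝ≥0∞ := 2 ^ n * a with hc
  have hct : c ≠ ∞ := ENNReal.mul_ne_top (by simp) hat
  obtain ⟨r, hr, hcr⟩ := exists_r c η hct hη
  have hB1 : 1 ≤ B := (hp1 0).trans (hB 0)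
  refine ⟨r, hr, 1 + a ^ (r - 1) * (1 - c ^ (r - 1) * η)⁻¹, le_self_add, ?_, ?_⟩
  · refine ENNReal.add_ne_top.2 ⟨one_ne_top, ENNReal.mul_ne_top
      (ENNReal.rpow_ne_top_of_nonneg (by linarith) hat) ?_⟩
    rw [Ne, ENNReal.inv_eq_top, tsub_eq_zero_iff_le, not_le]
    exact hcr
  intro S hS t ht hsum
  have hgen : ∀ Q : RCube n, ∃ D : ℕ → Set (RCube n), Q ∈ S → (D 0 = {Q} ∧ (∀ k, (D k).PairwiseDisjoint RCube.op) ∧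
      (∀ k, opU (D (k + 1)) ⊆ opU (D k)) ∧
      (∀ k, opU (D k) ⊆ Q.op) ∧
      (∀ k, ∀ P ∈ D k, a * volume (P.op ∩ opU (D (k + 1))) ≤ volume P.op) ∧
      ∀ k, ∀ᵐ x, x ∈ opU (D k) → x ∉ opU (D (k + 1)) →
        ENNReal.ofReal (t Q) ^ p x ≤ a * ((2 ^ n * a) ^ k * (phi p Q (t Q) / volume Q.op))) := by
    intro Q
    by_cases hQ : Q ∈ S
    · obtain ⟨D, hD⟩ := gen (fun x => ENNReal.ofReal (t Q) ^ p x) (measurable_const.pow hpm)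
        (fun P => phi_pos p hpm P (t Q) (ht Q hQ)) (fun P => phi_fin p hp1 B hB P (t Q)) a ha hat Q
      exact ⟨D, fun _ => hD⟩
    · exact ⟨fun _ => ∅, fun h => absurd h hQ⟩
  choose D hD using hgen
  have hdec := H S hS t ht D (fun Q hQ => by
    obtain ⟨h1, h2, h3, h4, h5, -⟩ := hD Q hQ
    exact ⟨h1, h2, h3, h4, h5⟩) hsum
  have hone : ∀ Q ∈ S, psi p r Q (t Q) ≤ phi p Q (t Q) + a ^ (r - 1) *
      ∑' k, (c ^ (r - 1)) ^ k * ∫⁻ x in opU (D Q k), ENNReal.ofReal (t Q) ^ p x := by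
    intro Q hQ
    obtain ⟨h1, h2, h3, h4, h5, h6⟩ := hD Q hQ
    apply rh_norm _ _ _ _ Q.vol_ne_zero Q.vol_ne_top r hr
    have h7 := rh_one (fun x => ENNReal.ofReal (t Q) ^ p x) (measurable_const.pow hpm)
      _ (bdd_ne_top (t Q) B hB1) (fun x => pow_bdd (t Q) B _ (hp1 x) (hB x))
      (fun k => opU (D Q k)) (fun k => opU_meas _) h3 r hr _ h6 (by
        refine tendsto_of_tendsto_of_tendsto_of_le_of_le tendsto_const_nhds
          (ENNReal.tendsto_pow_atTop_nhds_zero_of_lt_one hη) (fun _ => zero_le) ?_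
        intro k
        refine le_trans ?_ (hdec k)
        exact Finset.single_le_sum
          (f := fun Q => ∫⁻ x in opU (D Q k), ENNReal.ofReal (t Q) ^ p x) (fun _ _ => zero_le) hQ)
    simp only [h1] at h7
    have e1 : opU {Q} = Q.op := by simp [opU]
    rw [e1] at h7
    have e2 : ∫⁻ x in Q.op, ENNReal.ofReal (t Q) ^ (r * p x)
        = ∫⁻ x in Q.op, (ENNReal.ofReal (t Q) ^ p x) ^ r := by
      refine lintegral_congr fun x => ?_
      rw [← ENNReal.rpow_mul, mul_comm]
    rw [e2]
    refine h7.trans (le_of_eq ?_)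
    rw [← mul_assoc, ← ENNReal.tsum_mul_left]
    refine tsum_congr fun k => ?_
    have hr0 : 0 ≤ r - 1 := by linarith
    rw [ENNReal.mul_rpow_of_nonneg _ _ hr0, ENNReal.mul_rpow_of_nonneg _ _ hr0,
      ← hc, ← ENNReal.rpow_natCast, ← ENNReal.rpow_natCast, ← ENNReal.rpow_mul, ← ENNReal.rpow_mul,
      mul_comm (r - 1) (k : ℝ)]
    ring
  calc _ ≤ ∑ Q ∈ S, (phi p Q (t Q) + a ^ (r - 1) *
      ∑' k, (c ^ (r - 1)) ^ k * ∫⁻ x in opU (D Q k), ENNReal.ofReal (t Q) ^ p x) :=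
        Finset.sum_le_sum hone
    _ = (∑ Q ∈ S, phi p Q (t Q)) + a ^ (r - 1) *
      ∑' k, (c ^ (r - 1)) ^ k * ∑ Q ∈ S, ∫⁻ x in opU (D Q k), ENNReal.ofReal (t Q) ^ p x := by
        rw [Finset.sum_add_distrib, ← Finset.mul_sum]
        congr 2
        simp_rw [Finset.mul_sum]
        rw [Summable.tsum_finsetSum]
        intro i _; exact ENNReal.summable
    _ ≤ 1 + a ^ (r - 1) * ∑' k, (c ^ (r - 1)) ^ k * η ^ k := by
        gcongr with k
        exact hdec k
    _ = _ := by
        simp_rw [← mul_pow]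
        rw [ENNReal.tsum_geometric]

section prob
variable {α : Type*} [MeasurableSpace α] (ν : Measure α) [IsProbabilityMeasure ν]

lemma jens (g : α → ℝ≥0∞) (hg : Measurable g) (θ : ℝ) (h0 : 0 ≤ θ) (h1 : θ ≤ 1) :
    ∫⁻ x, g x ^ θ ∂ν ≤ (∫⁻ x, g x ∂ν) ^ θ := by
  have := ENNReal.lintegral_mul_norm_pow_le (μ := ν) hg.aemeasurable
    (aemeasurable_const (b := (1 : ℝ≥0∞))) h0 (sub_nonneg.2 h1) (by ring)
  simpa using this

lemma g1 (g : α → ℝ≥0∞) (hg : Measurable g) (r θ : ℝ) (hr : 1 < r) (h0 : 0 ≤ θ) (h1 : θ ≤ 1)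
    (K : ℝ≥0∞) (hK : 1 ≤ K) (hI0 : ∫⁻ x, g x ∂ν ≠ 0) (hIt : ∫⁻ x, g x ∂ν ≠ ∞)
    (h : (∫⁻ x, g x ^ r ∂ν) ^ (1 / r) ≤ K * ∫⁻ x, g x ∂ν) :
    (∫⁻ x, (g x ^ θ) ^ r ∂ν) ^ (1 / r) ≤ K ^ (1 + r / (r - 1)) * ∫⁻ x, g x ^ θ ∂ν := by
  set I := ∫⁻ x, g x ∂ν with hI
  set R := ∫⁻ x, g x ^ r ∂ν with hR
  set J := ∫⁻ x, g x ^ θ ∂ν with hJ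
  have hr0 : 0 < r := by linarith
  have hrθ : 0 < r - θ := by linarith
  have hr1 : 0 < r - 1 := by linarith
  have hRI : R ≤ (K * I) ^ r := by
    have := ENNReal.rpow_le_rpow h hr0.le
    rwa [← ENNReal.rpow_mul, one_div_mul_cancel hr0.ne', ENNReal.rpow_one] at this
  have s1 : (∫⁻ x, (g x ^ θ) ^ r ∂ν) ^ (1 / r) ≤ K * I ^ θ := by
    calc (∫⁻ x, (g x ^ θ) ^ r ∂ν) ^ (1 / r) = (∫⁻ x, (g x ^ r) ^ θ ∂ν) ^ (1 / r) := by
          congr 1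
          refine lintegral_congr fun x => ?_
          rw [← ENNReal.rpow_mul, ← ENNReal.rpow_mul, mul_comm]
      _ ≤ (R ^ θ) ^ (1 / r) := by
          gcongr
          exact jens ν _ (hg.pow_const _) θ h0 h1
      _ = (R ^ (1 / r)) ^ θ := by rw [← ENNReal.rpow_mul, ← ENNReal.rpow_mul, mul_comm]
      _ ≤ (K * I) ^ θ := by gcongr
      _ = K ^ θ * I ^ θ := ENNReal.mul_rpow_of_nonneg _ _ h0
      _ ≤ K * I ^ θ := by
          gcongr
          calc K ^ θ ≤ K ^ (1 : ℝ) := ENNReal.rpow_le_rpow_of_exponent_le hK h1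
            _ = K := ENNReal.rpow_one K
  have s2 : I ^ θ ≤ K ^ (r / (r - 1)) * J := by
    set x := (r - 1) / (r - θ) with hx
    set y := (1 - θ) / (r - θ) with hy
    have hx0 : 0 < x := by positivity
    have hy0 : 0 ≤ y := div_nonneg (by linarith) hrθ.le
    have hxy : x + y = 1 := by rw [hx, hy]; field_simp; ring
    have hcomb : θ * x + r * y = 1 := by rw [hx, hy]; field_simp; ring
    have hol : I ≤ J ^ x * R ^ y := by
      have := ENNReal.lintegral_mul_norm_pow_le (μ := ν) (hg.pow_const θ).aemeasurable
        (hg.pow_const r).aemeasurable hx0.le hy0 hxy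
      refine le_trans (le_of_eq ?_) this
      refine lintegral_congr fun z => ?_
      rw [← ENNReal.rpow_mul, ← ENNReal.rpow_mul, ← ENNReal.rpow_add_of_nonneg _ _ (by positivity)
        (by positivity), hcomb, ENNReal.rpow_one]
    set w := r * (1 - θ) / (r - 1) with hw
    have hw0 : 0 ≤ w := div_nonneg (mul_nonneg hr0.le (by linarith)) hr1.le
    have e1 : I ^ (1 / x) ≤ J * (K * I) ^ w := by
      calc I ^ (1 / x) ≤ (J ^ x * ((K * I) ^ r) ^ y) ^ (1 / x) := by
            gcongr
            exact hol.trans (by gcongr)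
        _ = J * (K * I) ^ w := by
            rw [ENNReal.mul_rpow_of_nonneg _ _ (by positivity), ← ENNReal.rpow_mul,
              mul_one_div_cancel hx0.ne', ENNReal.rpow_one, ← ENNReal.rpow_mul, ← ENNReal.rpow_mul]
            congr 2
            rw [hx, hy, hw]; field_simp
    have e2 : 1 / x = θ + w := by rw [hx, hw]; field_simp; ring
    rw [e2, ENNReal.rpow_add_of_nonneg _ _ h0 hw0, ENNReal.mul_rpow_of_nonneg _ _ hw0,
      ← mul_assoc] at e1
    have hIw0 : I ^ w ≠ 0 := (ENNReal.rpow_pos (pos_iff_ne_zero.2 hI0) hIt).ne'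
    have hIwt : I ^ w ≠ ∞ := ENNReal.rpow_ne_top_of_nonneg hw0 hIt
    have e3 := (ENNReal.mul_le_mul_iff_left hIw0 hIwt).1 e1
    refine e3.trans ?_
    rw [mul_comm]
    gcongr
    rw [hw]
    gcongr
    nlinarith
  calc _ ≤ K * I ^ θ := s1
    _ ≤ K * (K ^ (r / (r - 1)) * J) := by gcongr
    _ = _ := by
      rw [ENNReal.rpow_add_of_nonneg _ _ zero_le_one (by positivity), ENNReal.rpow_one, mul_assoc]

lemma g2 (g : α → ℝ≥0∞) (hg : Measurable g) (γ : ℝ) (hγ : 1 < γ) (K : ℝ≥0∞)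
    (h : (∫⁻ x, g x ^ (γ * γ) ∂ν) ^ (1 / (γ * γ)) ≤ K * ∫⁻ x, g x ∂ν) :
    (∫⁻ x, (g x ^ γ) ^ γ ∂ν) ^ (1 / γ) ≤ K ^ γ * ∫⁻ x, g x ^ γ ∂ν := by
  have hγ0 : 0 < γ := by linarith
  calc (∫⁻ x, (g x ^ γ) ^ γ ∂ν) ^ (1 / γ)
      = ((∫⁻ x, g x ^ (γ * γ) ∂ν) ^ (1 / (γ * γ))) ^ γ := by
        simp_rw [← ENNReal.rpow_mul]
        congr 1; field_simp
    _ ≤ (K * ∫⁻ x, g x ∂ν) ^ γ := by gcongr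
    _ = K ^ γ * (∫⁻ x, g x ∂ν) ^ γ := ENNReal.mul_rpow_of_nonneg _ _ hγ0.le
    _ ≤ K ^ γ * ∫⁻ x, g x ^ γ ∂ν := by
        gcongr
        have := jens ν (fun x => g x ^ γ) (hg.pow_const _) (1 / γ) (by positivity)
          (by rw [div_le_one hγ0]; exact hγ.le)
        have h2 := ENNReal.rpow_le_rpow this hγ0.le
        simpa [← ENNReal.rpow_mul, hγ0.ne'] using h2

lemma g3 (g : α → ℝ≥0∞) (hg : Measurable g) (γ r : ℝ) (hγ : 0 < γ) (hr : γ ≤ r) :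
    (∫⁻ x, g x ^ γ ∂ν) ^ (1 / γ) ≤ (∫⁻ x, g x ^ r ∂ν) ^ (1 / r) := by
  have hr0 : 0 < r := by linarith
  have := jens ν (fun x => g x ^ r) (hg.pow_const _) (γ / r) (by positivity)
    (by rw [div_le_one hr0]; exact hr)
  have h2 := ENNReal.rpow_le_rpow this (z := 1 / γ) (by positivity)
  rw [← ENNReal.rpow_mul] at h2
  refine le_trans (le_of_eq ?_) (h2.trans (le_of_eq ?_))
  · congr 1
    refine lintegral_congr fun x => ?_
    rw [← ENNReal.rpow_mul]; congr 1; field_simp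
  · congr 1; field_simp

end prob

/-- normalized measure -/
def nu {n : ℕ} (Q : RCube n) : Measure (Fin n → ℝ) := (volume Q.op)⁻¹ • volume.restrict Q.op

instance {n : ℕ} (Q : RCube n) : IsProbabilityMeasure (nu Q) := by
  constructor
  simp [nu, ENNReal.inv_mul_cancel Q.vol_ne_zero Q.vol_ne_top]

lemma nu_int {n : ℕ} (Q : RCube n) (g : (Fin n → ℝ) → ℝ≥0∞) :
    ∫⁻ x, g x ∂(nu Q) = (∫⁻ x in Q.op, g x) / volume Q.op := by
  rw [nu, lintegral_smul_measure, smul_eq_mul, mul_comm, div_eq_mul_inv]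

lemma phi_nu {n : ℕ} (p : (Fin n → ℝ) → ℝ) (Q : RCube n) (t : ℝ) :
    phi p Q t = volume Q.op * ∫⁻ x, ENNReal.ofReal t ^ p x ∂(nu Q) := by
  rw [nu_int, ENNReal.mul_div_cancel Q.vol_ne_zero Q.vol_ne_top, phi]

lemma psi_nu {n : ℕ} (p : (Fin n → ℝ) → ℝ) (r : ℝ) (Q : RCube n) (t : ℝ) :
    psi p r Q t = volume Q.op * (∫⁻ x, (ENNReal.ofReal t ^ p x) ^ r ∂(nu Q)) ^ (1 / r) := by
  rw [nu_int, psi]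
  simp_rw [← ENNReal.rpow_mul, mul_comm]

lemma good_iff {n : ℕ} (p : (Fin n → ℝ) → ℝ) (r : ℝ) (Q : RCube n) (t : ℝ) (K : ℝ≥0∞) :
    psi p r Q t ≤ K * phi p Q t ↔
    (∫⁻ x, (ENNReal.ofReal t ^ p x) ^ r ∂(nu Q)) ^ (1 / r) ≤
      K * ∫⁻ x, ENNReal.ofReal t ^ p x ∂(nu Q) := by
  rw [psi_nu, phi_nu, mul_left_comm, ENNReal.mul_le_mul_iff_right Q.vol_ne_zero Q.vol_ne_top]

lemma ofReal_pow_swap (t θ q : ℝ) (ht : 0 < t) :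
    ENNReal.ofReal (t ^ θ) ^ q = (ENNReal.ofReal t ^ q) ^ θ := by
  rw [← ENNReal.ofReal_rpow_of_pos ht, ← ENNReal.rpow_mul, ← ENNReal.rpow_mul, mul_comm]

section cube
variable {n : ℕ} (p : (Fin n → ℝ) → ℝ)

lemma good_theta (hpm : Measurable p) (hp1 : ∀ x, 1 ≤ p x)
    (B : ℝ) (hB : ∀ x, p x ≤ B) (r : ℝ) (hr : 1 < r) (Q : RCube n) (t : ℝ) (ht : 0 < t)
    (K : ℝ≥0∞) (hK : 1 ≤ K) (h : psi p r Q t ≤ K * phi p Q t) (θ : ℝ) (h0 : 0 ≤ θ) (h1 : θ ≤ 1) :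
    psi p r Q (t ^ θ) ≤ K ^ (1 + r / (r - 1)) * phi p Q (t ^ θ) := by
  rw [good_iff] at h ⊢
  simp_rw [ofReal_pow_swap t θ _ ht]
  apply g1 _ _ (measurable_const.pow hpm) r θ hr h0 h1 K hK _ _ h
  · intro h; apply phi_pos p hpm Q t ht; rw [phi_nu, h, mul_zero]
  · intro h; apply phi_fin p hp1 B hB Q t; rw [phi_nu, h, ENNReal.mul_top Q.vol_ne_zero]

lemma good_gamma (hpm : Measurable p) (γ : ℝ) (hγ : 1 < γ) (Q : RCube n) (t : ℝ) (ht : 0 < t)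
    (K : ℝ≥0∞) (h : psi p (γ * γ) Q t ≤ K * phi p Q t) :
    psi p γ Q (t ^ γ) ≤ K ^ γ * phi p Q (t ^ γ) := by
  rw [good_iff] at h ⊢
  simp_rw [ofReal_pow_swap t γ _ ht]
  exact g2 _ _ (measurable_const.pow hpm) γ hγ K h

lemma psi_mono (hpm : Measurable p) (γ r : ℝ) (hγ : 0 < γ) (hr : γ ≤ r) (Q : RCube n) (t : ℝ) :
    psi p γ Q t ≤ psi p r Q t := by
  rw [psi_nu, psi_nu]
  gcongr
  exact g3 _ _ (measurable_const.pow hpm) γ r hγ hr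

lemma psi_scale (hpm : Measurable p) (hp1 : ∀ x, 1 ≤ p x) (γ : ℝ) (hγ : 0 < γ) (Q : RCube n)
    (c s : ℝ) (hc : 0 < c) (hc1 : c ≤ 1) :
    psi p γ Q (c * s) ≤ ENNReal.ofReal c * psi p γ Q s := by
  rw [psi_nu, psi_nu, mul_left_comm]
  gcongr
  have h : ∫⁻ x, (ENNReal.ofReal (c * s) ^ p x) ^ γ ∂(nu Q) ≤
      ENNReal.ofReal c ^ γ * ∫⁻ x, (ENNReal.ofReal s ^ p x) ^ γ ∂(nu Q) := by
    rw [← lintegral_const_mul _ ((measurable_const.pow hpm).pow_const _)]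
    refine lintegral_mono fun x => ?_
    rw [ENNReal.ofReal_mul hc.le, ← ENNReal.mul_rpow_of_nonneg _ _ hγ.le,
      ENNReal.mul_rpow_of_nonneg _ _ (by linarith [hp1 x])]
    gcongr
    calc _ ≤ ENNReal.ofReal c ^ (1 : ℝ) := ENNReal.rpow_le_rpow_of_exponent_ge
          (by simpa using hc1) (hp1 x)
      _ = _ := ENNReal.rpow_one _
  calc _ ≤ (ENNReal.ofReal c ^ γ * ∫⁻ x, (ENNReal.ofReal s ^ p x) ^ γ ∂(nu Q)) ^ (1 / γ) := by
        gcongr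
    _ = _ := by
        rw [ENNReal.mul_rpow_of_nonneg _ _ (by positivity), ← ENNReal.rpow_mul,
          mul_one_div_cancel hγ.ne', ENNReal.rpow_one]

lemma phi_mono (hp1 : ∀ x, 1 ≤ p x) (Q : RCube n) {s t : ℝ} (h : s ≤ t) :
    phi p Q s ≤ phi p Q t := by
  refine lintegral_mono fun x => ?_
  have := hp1 x
  gcongr

lemma phi_mul_le (hpm : Measurable p) (hp1 : ∀ x, 1 ≤ p x) (B : ℝ) (hB : ∀ x, p x ≤ B)
    (Q : RCube n) (c t : ℝ) (hc : 1 ≤ c) :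
    phi p Q (c * t) ≤ ENNReal.ofReal c ^ B * phi p Q t := by
  rw [phi, phi, ← lintegral_const_mul _ (measurable_const.pow hpm)]
  refine lintegral_mono fun x => ?_
  rw [ENNReal.ofReal_mul (by linarith)]
  exact mul_pow_le (by simpa using hc) (hp1 x) (hB x)

lemma le_phi_mul (hpm : Measurable p) (hp1 : ∀ x, 1 ≤ p x)
    (Q : RCube n) (c t : ℝ) (hc : 1 ≤ c) :
    ENNReal.ofReal c * phi p Q t ≤ phi p Q (c * t) := by
  rw [phi, phi, ← lintegral_const_mul _ (measurable_const.pow hpm)]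
  refine lintegral_mono fun x => ?_
  rw [ENNReal.ofReal_mul (by linarith)]
  exact le_mul_pow (by simpa using hc) (hp1 x)

lemma find_T (hpm : Measurable p) (hp1 : ∀ x, 1 ≤ p x) (B : ℝ) (hB : ∀ x, p x ≤ B)
    (Q : RCube n) (t : ℝ) (ht : 0 < t) (h : phi p Q t ≤ 1) :
    ∃ T, t ≤ T ∧ phi p Q T ≤ 1 ∧ 1 ≤ 2 ^ B * phi p Q T := by
  have hpos := phi_pos p hpm Q t ht
  have hfin := phi_fin p hp1 B hB Q t
  have hex : ∃ k : ℕ, 1 < phi p Q (2 ^ k * t) := by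
    obtain ⟨k, hk⟩ := ENNReal.exists_nat_mul_gt hpos (one_ne_top)
    refine ⟨k, hk.trans_le ?_⟩
    refine le_trans ?_ (le_phi_mul p hpm hp1 Q (2 ^ k) t (one_le_pow₀ (by norm_num)))
    gcongr
    rw [← ENNReal.ofReal_natCast]
    apply ENNReal.ofReal_le_ofReal
    exact_mod_cast Nat.lt_two_pow_self.le
  classical
  obtain ⟨k, hk⟩ : ∃ k, Nat.find hex = k + 1 := by
    apply Nat.exists_eq_succ_of_ne_zero
    intro h0
    have := Nat.find_spec hex
    rw [h0] at this
    simp only [pow_zero, one_mul] at this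
    exact absurd h (not_le.2 this)
  refine ⟨2 ^ k * t, ?_, ?_, ?_⟩
  · have : (1 : ℝ) ≤ 2 ^ k := one_le_pow₀ (by norm_num)
    nlinarith
  · exact not_lt.1 (Nat.find_min hex (by omega))
  · have := Nat.find_spec hex
    rw [hk, pow_succ', mul_assoc] at this
    refine this.le.trans ?_
    have h2 := phi_mul_le p hpm hp1 B hB Q 2 (2 ^ k * t) (by norm_num)
    simpa using h2

lemma exists_theta (T s : ℝ) (hT : 0 < T) (hs : 0 < s)
    (h : (1 ≤ s ∧ s ≤ T) ∨ (T ≤ s ∧ s < 1)) : ∃ θ : ℝ, 0 ≤ θ ∧ θ ≤ 1 ∧ T ^ θ = s := by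
  by_cases h1 : T = 1
  · refine ⟨0, le_rfl, zero_le_one, ?_⟩
    rw [Real.rpow_zero]
    rcases h with h | h <;> linarith
  have hlT : Real.log T ≠ 0 := Real.log_ne_zero_of_pos_of_ne_one hT h1
  refine ⟨Real.log s / Real.log T, ?_, ?_, ?_⟩
  · rcases h with h | h
    · exact div_nonneg (Real.log_nonneg h.1) (Real.log_nonneg (by linarith))
    · exact div_nonneg_of_nonpos (Real.log_nonpos hs.le h.2.le)
        (Real.log_nonpos hT.le (by linarith))
  · rcases h with h | h
    · have h2 : 0 < Real.log T := lt_of_le_of_ne (Real.log_nonneg (by linarith)) hlT.symm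
      rw [div_le_one h2]
      exact Real.log_le_log hs h.2
    · have h2 : Real.log T < 0 := lt_of_le_of_ne (Real.log_nonpos hT.le (by linarith)) hlT
      rw [div_le_one_of_neg h2]
      exact Real.log_le_log hT h.1
  · rw [Real.rpow_def_of_pos hT, mul_div_cancel₀ _ hlT, Real.exp_log hs]

end cube

lemma greedy {n : ℕ} (p : (Fin n → ℝ) → ℝ) (r : ℝ) (C K : ℝ≥0∞) (hC : 1 ≤ C) (hCt : C ≠ ∞)
    (hKC : 2 * C ≤ K)
    (H : ∀ (S : Finset (RCube n)), (S : Set (RCube n)).PairwiseDisjoint RCube.op →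
      ∀ (t : RCube n → ℝ), (∀ Q ∈ S, 0 < t Q) →
      ∑ Q ∈ S, phi p Q (t Q) ≤ 1 → ∑ Q ∈ S, psi p r Q (t Q) ≤ C)
    (s : RCube n → ℝ) (S : Finset (RCube n)) (hS : (S : Set (RCube n)).PairwiseDisjoint RCube.op)
    (hs : ∀ Q ∈ S, 0 < s Q ∧ phi p Q (s Q) ≤ 1 ∧ K * phi p Q (s Q) ≤ psi p r Q (s Q)) :
    ∑ Q ∈ S, phi p Q (s Q) ≤ 1 / 2 ∧ ∑ Q ∈ S, psi p r Q (s Q) ≤ C := by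
  have hC0 : C ≠ 0 := (lt_of_lt_of_le one_pos hC).ne'
  have step : ∀ S : Finset (RCube n), (S : Set (RCube n)).PairwiseDisjoint RCube.op →
      (∀ Q ∈ S, 0 < s Q ∧ phi p Q (s Q) ≤ 1 ∧ K * phi p Q (s Q) ≤ psi p r Q (s Q)) →
      ∑ Q ∈ S, phi p Q (s Q) ≤ 1 →
      ∑ Q ∈ S, phi p Q (s Q) ≤ 1 / 2 ∧ ∑ Q ∈ S, psi p r Q (s Q) ≤ C := by
    intro S hS hs h1
    have h2 := H S hS s (fun Q hQ => (hs Q hQ).1) h1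
    refine ⟨?_, h2⟩
    have h3 : C * (2 * ∑ Q ∈ S, phi p Q (s Q)) ≤ C * 1 := by
      calc _ = (2 * C) * ∑ Q ∈ S, phi p Q (s Q) := by ring
        _ ≤ K * ∑ Q ∈ S, phi p Q (s Q) := by gcongr
        _ = ∑ Q ∈ S, K * phi p Q (s Q) := Finset.mul_sum _ _ _
        _ ≤ ∑ Q ∈ S, psi p r Q (s Q) := Finset.sum_le_sum fun Q hQ => (hs Q hQ).2.2
        _ ≤ C * 1 := by rw [mul_one]; exact h2
    have h4 := (ENNReal.mul_le_mul_iff_right hC0 hCt).1 h3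
    rw [ENNReal.le_div_iff_mul_le (by simp) (by simp), mul_comm]
    exact h4
  classical
  induction S using Finset.induction with
  | empty => simp
  | insert Q S hQ ih =>
    have ih' := ih (hS.subset (by simp)) (fun P hP => hs P (Finset.mem_insert_of_mem hP))
    have hone := step {Q} (by simp) (by
      intro P hP
      rw [Finset.mem_singleton] at hP; subst hP
      exact hs P (Finset.mem_insert_self _ _)) (by
        simpa using (hs Q (Finset.mem_insert_self _ _)).2.1)
    apply step _ hS hs
    rw [Finset.sum_insert hQ]
    have h1 := hone.1
    rw [Finset.sum_singleton] at h1
    calc _ ≤ (1 / 2 + 1 / 2 : ℝ≥0∞) := add_le_add h1 ih'.1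
      _ = 1 := ENNReal.add_halves 1

lemma main_bdd {n : ℕ} (p : (Fin n → ℝ) → ℝ) (hpm : Measurable p) (hp1 : ∀ x, 1 ≤ p x)
    (B : ℝ) (hB : ∀ x, p x ≤ B) (hA : AInfty p) :
    ∃ γ : ℝ, 1 < γ ∧ ∃ A : ℝ≥0∞, A ≠ ∞ ∧ 1 ≤ A ∧ ∃ δ : ℝ, 0 < δ ∧ ∃ b : RCube n → ℝ≥0∞,
      (∀ Q : RCube n, b Q ≠ ∞) ∧
      (∀ S : Finset (RCube n), (S : Set (RCube n)).PairwiseDisjoint RCube.op →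
        ∑ Q ∈ S, b Q ≤ 2) ∧
      ∀ Q : RCube n, ∀ t : ℝ, 0 < t → phi p Q t ≤ 1 →
        psi p γ Q t ≤ A * (phi p Q t +
            (if t < 1 then ENNReal.ofReal (t ^ δ) * b Q else 0)) := by
  obtain ⟨r, hr, C, hC1, hCt, H⟩ := rh p hpm hp1 B hB hA
  obtain ⟨γ, hγ, rfl⟩ : ∃ γ : ℝ, 1 < γ ∧ r = γ * γ :=
    ⟨Real.sqrt r, by rw [Real.lt_sqrt (by norm_num)]; linarith, (Real.mul_self_sqrt (by linarith)).symm⟩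
  have hγ0 : 0 < γ := by linarith
  have hB1 : 1 ≤ B := (hp1 0).trans (hB 0)
  have hC0 : C ≠ 0 := (lt_of_lt_of_le one_pos hC1).ne'
  have Hone : ∀ (Q : RCube n) (t : ℝ), 0 < t → phi p Q t ≤ 1 → psi p (γ * γ) Q t ≤ C := by
    intro Q t ht h
    have := H {Q} (by simp) (fun _ => t) (fun _ _ => ht) (by simpa using h)
    simpa using this
  set K0 : ℝ≥0∞ := C * 2 ^ B with hK0
  have h2B : (1 : ℝ≥0∞) ≤ 2 ^ B := ENNReal.one_le_rpow (by norm_num) (by linarith)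
  have hK01 : 1 ≤ K0 := by
    calc (1 : ℝ≥0∞) = 1 * 1 := by simp
      _ ≤ C * 2 ^ B := by gcongr
  have hK0t : K0 ≠ ∞ := ENNReal.mul_ne_top hCt
    (ENNReal.rpow_ne_top_of_nonneg (by linarith) (by simp))
  set K' : ℝ≥0∞ := K0 ^ (1 + (γ * γ) / (γ * γ - 1)) with hK'
  have hK't : K' ≠ ∞ := by
    refine ENNReal.rpow_ne_top_of_nonneg ?_ hK0t
    have : 0 < γ * γ - 1 := by linarith
    positivity
  set K : ℝ≥0∞ := max (2 * C) K' with hK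
  have hKt : K ≠ ∞ := (max_lt (ENNReal.mul_lt_top (by simp) hCt.lt_top) hK't.lt_top).ne
  -- goodness
  have hgood : ∀ (Q : RCube n) (t s : ℝ), 0 < t → 0 < s → phi p Q t ≤ 1 →
      ((1 ≤ s ∧ s = t) ∨ (s < 1 ∧ 1 < phi p Q s)) →
      psi p (γ * γ) Q s ≤ K * phi p Q s := by
    intro Q t s ht hs h hh
    obtain ⟨T, htT, hT1, hT2⟩ := find_T p hpm hp1 B hB Q t ht h
    have hT0 : 0 < T := by linarith
    have hTg : psi p (γ * γ) Q T ≤ K0 * phi p Q T := by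
      calc _ ≤ C * 1 := by rw [mul_one]; exact Hone Q T hT0 hT1
        _ ≤ C * (2 ^ B * phi p Q T) := by gcongr
        _ = _ := by rw [hK0, mul_assoc]
    obtain ⟨θ, h0, h1, rfl⟩ := exists_theta T s hT0 hs (by
      rcases hh with ⟨h1, rfl⟩ | ⟨h1, h2⟩
      · exact Or.inl ⟨h1, htT⟩
      · refine Or.inr ⟨?_, h1⟩
        by_contra hlt
        push Not at hlt
        exact absurd ((phi_mono p hp1 Q hlt.le).trans hT1) (not_le.2 h2))
    refine (good_theta p hpm hp1 B hB _ hr Q T hT0 K0 hK01 hTg θ h0 h1).trans ?_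
    gcongr
    exact le_max_right _ _
  let Bd : RCube n → ℝ → Prop := fun Q s =>
    0 < s ∧ s < 1 ∧ phi p Q s ≤ 1 ∧ K * phi p Q s < psi p (γ * γ) Q s
  let sp : RCube n → ℝ≥0∞ := fun Q => ⨆ (s : ℝ) (_ : Bd Q s), psi p (γ * γ) Q s
  have hsp : ∀ Q, sp Q ≤ C := fun Q =>
    iSup_le fun s => iSup_le fun hs => Hone Q s hs.1 hs.2.2.1
  have hch : ∀ Q, ∃ s, (∃ s', Bd Q s') → (Bd Q s ∧ sp Q ≤ 2 * psi p (γ * γ) Q s) := by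
    intro Q
    by_cases hex : ∃ s', Bd Q s'
    · obtain ⟨s', hs'⟩ := hex
      have hpos : sp Q ≠ 0 := by
        have : psi p (γ * γ) Q s' ≤ sp Q := le_iSup₂_of_le s' hs' le_rfl
        exact (lt_of_lt_of_le (lt_of_le_of_lt zero_le hs'.2.2.2) this).ne'
      have hlt : sp Q / 2 < sp Q := ENNReal.half_lt_self hpos (ne_top_of_le_ne_top hCt (hsp Q))
      obtain ⟨s, hs⟩ := lt_iSup_iff.1 hlt
      obtain ⟨hb, hs⟩ := lt_iSup_iff.1 hs
      refine ⟨s, fun _ => ⟨hb, ?_⟩⟩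
      have := (ENNReal.div_le_iff (by simp) (by simp)).1 hs.le
      rwa [mul_comm]
    · exact ⟨0, fun h => absurd h hex⟩
  choose s hs using hch
  have hA1 : 1 ≤ K ^ γ + K + C := hC1.trans le_add_self
  refine ⟨γ, hγ, K ^ γ + K + C, ?_, hA1, (γ - 1) / γ, div_pos (by linarith) hγ0,
    fun Q => C⁻¹ * sp Q, ?_, ?_, ?_⟩
  · simp [hKt, hCt, ENNReal.rpow_ne_top_of_nonneg hγ0.le hKt]
  · intro Q
    exact ENNReal.mul_ne_top (by simp [hC0]) (ne_top_of_le_ne_top hCt (hsp Q))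
  · intro S hS
    classical
    rw [← Finset.mul_sum]
    have h1 : ∑ Q ∈ S, sp Q = ∑ Q ∈ S.filter (fun Q => ∃ s', Bd Q s'), sp Q := by
      symm
      apply Finset.sum_subset (Finset.filter_subset _ _)
      intro Q hQ hQ'
      rw [Finset.mem_filter, not_and] at hQ'
      have := hQ' hQ
      rw [← nonpos_iff_eq_zero]
      exact iSup_le fun s => iSup_le fun hs => absurd ⟨s, hs⟩ this
    have h2 := (greedy p (γ * γ) C K hC1 hCt (le_max_left _ _) H s
      (S.filter (fun Q => ∃ s', Bd Q s')) (hS.subset (Finset.coe_subset.2 (Finset.filter_subset _ _))) (by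
        intro Q hQ
        have := (hs Q (Finset.mem_filter.1 hQ).2).1
        exact ⟨this.1, this.2.2.1, this.2.2.2.le⟩)).2
    calc _ ≤ C⁻¹ * ∑ Q ∈ S.filter (fun Q => ∃ s', Bd Q s'), 2 * psi p (γ * γ) Q (s Q) := by
          rw [h1]
          gcongr with Q hQ
          exact (hs Q (Finset.mem_filter.1 hQ).2).2
      _ ≤ C⁻¹ * (2 * C) := by
          rw [← Finset.mul_sum]; gcongr
      _ = 2 := by
          rw [mul_left_comm, ENNReal.inv_mul_cancel hC0 hCt, mul_one]
  · intro Q t ht hphi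
    by_cases ht1 : t < 1
    · rw [if_pos ht1]
      set u : ℝ := t ^ (1 / γ) with hu
      have hu0 : 0 < u := Real.rpow_pos_of_pos ht _
      have hu1 : u < 1 := Real.rpow_lt_one ht.le ht1 (by positivity)
      have hut : u ^ γ = t := by
        rw [hu, ← Real.rpow_mul ht.le, one_div_mul_cancel hγ0.ne', Real.rpow_one]
      by_cases hg : psi p (γ * γ) Q u ≤ K * phi p Q u
      · have := good_gamma p hpm γ hγ Q u hu0 K hg
        rw [hut] at this
        calc _ ≤ _ := this
          _ ≤ _ := by
            gcongr
            · rw [add_assoc]; exact le_self_add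
            · exact le_self_add
      · have hphu : phi p Q u ≤ 1 := by
          by_contra hlt
          push Not at hlt
          exact hg (hgood Q t u ht hu0 hphi (Or.inr ⟨hu1, hlt⟩))
        have hbd : Bd Q u := ⟨hu0, hu1, hphu, not_le.1 hg⟩
        have hle : psi p (γ * γ) Q u ≤ sp Q := le_iSup₂_of_le u hbd le_rfl
        have e1 : t = t ^ ((γ - 1) / γ) * u := by
          rw [hu, ← Real.rpow_add ht]
          conv_lhs => rw [← Real.rpow_one t]
          congr 1; field_simp; ring
        calc psi p γ Q t = psi p γ Q (t ^ ((γ - 1) / γ) * u) := by rw [← e1]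
          _ ≤ ENNReal.ofReal (t ^ ((γ - 1) / γ)) * psi p γ Q u :=
              psi_scale p hpm hp1 γ hγ0 Q _ _ (Real.rpow_pos_of_pos ht _)
                (Real.rpow_le_one ht.le ht1.le (div_nonneg (by linarith) hγ0.le))
          _ ≤ ENNReal.ofReal (t ^ ((γ - 1) / γ)) * sp Q := by
              gcongr
              exact (psi_mono p hpm γ (γ * γ) hγ0 (by nlinarith) Q u).trans hle
          _ = C * (ENNReal.ofReal (t ^ ((γ - 1) / γ)) * (C⁻¹ * sp Q)) := by
              rw [mul_left_comm, ← mul_assoc C, ENNReal.mul_inv_cancel hC0 hCt, one_mul]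
          _ ≤ _ := by
              gcongr
              · exact le_add_self
              · exact le_add_self
    · rw [if_neg ht1, add_zero]
      push Not at ht1
      calc psi p γ Q t ≤ psi p (γ * γ) Q t := psi_mono p hpm γ (γ * γ) hγ0 (by nlinarith) Q t
        _ ≤ K * phi p Q t := hgood Q t t ht ht hphi (Or.inl ⟨ht1, rfl⟩)
        _ ≤ _ := by
          gcongr
          rw [add_assoc, add_left_comm]; exact le_self_add

lemma vnorm_congr {n : ℕ} (p q : (Fin n → ℝ) → ℝ) (h : p =ᵐ[volume] q) (f : (Fin n → ℝ) → ℝ≥0∞) :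
    vnorm p f = vnorm q f := by
  unfold vnorm
  congr 1
  ext lam
  have : ∫⁻ x, (f x / lam) ^ p x = ∫⁻ x, (f x / lam) ^ q x := by
    refine lintegral_congr_ae ?_
    filter_upwards [h] with x hx
    rw [hx]
  simp only [mem_ofPred_eq, this]

lemma phi_le_one {n : ℕ} (p : (Fin n → ℝ) → ℝ) (hpm : Measurable p) (hp1 : ∀ x, 1 ≤ p x)
    (B : ℝ) (hB : ∀ x, p x ≤ B) (Q : RCube n) (t : ℝ) (ht : 0 < t)
    (h : ENNReal.ofReal t ≤ (vnorm p (chiE Q.toSet))⁻¹) : phi p Q t ≤ 1 := by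
  have h1 : ∀ t', 0 < t' → t' < t → phi p Q t' ≤ 1 := by
    intro t' ht' htt
    have h2 : vnorm p (chiE Q.toSet) < (ENNReal.ofReal t')⁻¹ := by
      refine lt_of_le_of_lt (ENNReal.le_inv_iff_le_inv.1 h) ?_
      rw [ENNReal.inv_lt_inv]
      exact (ENNReal.ofReal_lt_ofReal_iff ht).2 htt
    obtain ⟨lam, ⟨hl0, hl1⟩, hl2⟩ := sInf_lt_iff.1 h2
    refine le_trans ?_ hl1
    refine le_trans ?_ (setLIntegral_le_lintegral Q.op _)
    refine setLIntegral_mono' Q.meas_op fun x hx => ?_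
    have := hp1 x
    gcongr
    rw [chiE, indicator_of_mem (Q.op_subset hx), one_div]
    exact (ENNReal.le_inv_iff_le_inv.1 hl2.le)
  have h2 : ∀ c : ℝ, 1 < c → phi p Q t ≤ ENNReal.ofReal c ^ B := by
    intro c hc
    have h3 := phi_mul_le p hpm hp1 B hB Q c (t / c) hc.le
    rw [mul_div_cancel₀ _ (by linarith)] at h3
    calc _ ≤ _ := h3
      _ ≤ ENNReal.ofReal c ^ B * 1 := by
        gcongr
        exact h1 _ (by positivity) (div_lt_self ht hc)
      _ = _ := mul_one _
  have hcont : Continuous fun c : ℝ => ENNReal.ofReal c ^ B :=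
    ENNReal.continuous_rpow_const.comp ENNReal.continuous_ofReal
  have hlim : Filter.Tendsto (fun c : ℝ => ENNReal.ofReal c ^ B) (nhdsWithin 1 (Ioi 1)) (nhds 1) := by
    have := hcont.tendsto 1
    simp only [ENNReal.ofReal_one, ENNReal.one_rpow] at this
    exact this.mono_left nhdsWithin_le_nhds
  refine ge_of_tendsto hlim ?_
  filter_upwards [self_mem_nhdsWithin] with c hc
  exact h2 c hc

theorem statement9 {n : ℕ} (p : (Fin n → ℝ) → ℝ) (hpm : Measurable p)
    (hp1 : ∀ x, 1 ≤ p x)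
    (hup : ∃ B : ℝ, ∀ᵐ x ∂(volume : Measure (Fin n → ℝ)), p x ≤ B)
    (hA : AInfty p) :
    ∃ γ : ℝ, 1 < γ ∧ ∃ A : ℝ, 0 < A ∧ ∃ δ : ℝ, 0 < δ ∧ ∃ b : RCube n → ℝ≥0∞,
      (∀ Q : RCube n, b Q ≠ ∞) ∧
      (∀ F : Set (RCube n), PairwiseDisjointCubes F → (∑' Q : F, b Q.1) ≤ 2) ∧
      ∀ Q : RCube n, ∀ t : ℝ, 0 < t → ENNReal.ofReal t ≤ (vnorm p (chiE Q.toSet))⁻¹ →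
        volume Q.toSet *
            ((∫⁻ x in Q.toSet, ENNReal.ofReal t ^ (γ * p x)) / volume Q.toSet) ^ (1 / γ) ≤
          ENNReal.ofReal A * ((∫⁻ x in Q.toSet, ENNReal.ofReal t ^ p x) +
            (if t < 1 then ENNReal.ofReal (t ^ δ) * b Q else 0)) := by
  obtain ⟨B0, hB0⟩ := hup
  set B : ℝ := max B0 1 with hBdef
  let q : (Fin n → ℝ) → ℝ := fun x => min (p x) B
  have hqm : Measurable q := hpm.min measurable_const
  have hq1 : ∀ x, 1 ≤ q x := fun x => le_min (hp1 x) (le_max_right _ _)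
  have hqB : ∀ x, q x ≤ B := fun x => min_le_right _ _
  have hpq : p =ᵐ[volume] q := by
    filter_upwards [hB0] with x hx
    exact (min_eq_left (hx.trans (le_max_left _ _))).symm
  have hAq : AInfty q := by
    obtain ⟨lam, hl, C, hC, h⟩ := hA
    refine ⟨lam, hl, C, hC, ?_⟩
    intro F hF t ht E hE
    rw [← vnorm_congr p q hpq, ← vnorm_congr p q hpq]
    exact h F hF t ht E hE
  obtain ⟨γ, hγ, A, hAt, hA1, δ, hδ, b, hb, hsum, hmain⟩ := main_bdd q hqm hq1 B hqB hAq
  refine ⟨γ, hγ, A.toReal, ENNReal.toReal_pos (lt_of_lt_of_le one_pos hA1).ne' hAt, δ, hδ, b, hb,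
    ?_, ?_⟩
  · intro F hF
    rw [ENNReal.tsum_eq_iSup_sum]
    refine iSup_le fun S => ?_
    have h1 := hsum (S.map (Function.Embedding.subtype _)) (by
      intro P hP R hR hne
      simp only [Finset.coe_map, Function.Embedding.subtype_apply, mem_image, Finset.mem_coe] at hP hR
      obtain ⟨P, -, rfl⟩ := hP
      obtain ⟨R, -, rfl⟩ := hR
      exact (hF P.2 R.2 hne).mono (RCube.op_subset _) (RCube.op_subset _))
    rw [Finset.sum_map] at h1
    exact h1
  · intro Q t ht htn
    rw [vnorm_congr p q hpq] at htn
    have h1 := hmain Q t ht (phi_le_one q hqm hq1 B hqB Q t ht htn)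
    have e1 : ∫⁻ x in Q.toSet, ENNReal.ofReal t ^ p x = phi q Q t := by
      rw [RCube.setL, phi]
      refine lintegral_congr_ae (ae_restrict_of_ae ?_)
      filter_upwards [hpq] with x hx
      rw [hx]
    have e2 : ∫⁻ x in Q.toSet, ENNReal.ofReal t ^ (γ * p x)
        = ∫⁻ x in Q.op, ENNReal.ofReal t ^ (γ * q x) := by
      rw [RCube.setL]
      refine lintegral_congr_ae (ae_restrict_of_ae ?_)
      filter_upwards [hpq] with x hx
      rw [hx]
    rw [e1, e2, RCube.vol_eq, ENNReal.ofReal_toReal hAt]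
    exact h1
end
end

section
/- For every measurable function f on ℝ^n, every λ ∈ (0,1), and every α > 0, one has the set equality { x ∈ ℝ^n : m_λ f(x) > α } = { x ∈ ℝ^n : M χ_{{|f| > α}}(x) > λ }. -/
open MeasureTheory ENNReal Set

noncomputable section

theorem RCube.toSet_eq_s11 {n : ℕ} (Q : RCube n) :
    Q.toSet = Metric.closedBall Q.center (Q.side / 2) := by
  ext x
  have h : 0 ≤ Q.side / 2 := by have := Q.side_pos; linarith
  simp [RCube.toSet, Metric.mem_closedBall, dist_pi_le_iff h, Real.dist_eq]

theorem lt_rearr_iff {n : ℕ} (f : (Fin n → ℝ) → ℝ) (Q : RCube n) (s : ℝ≥0∞)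
    (α : ℝ) (hα : 0 < α) :
    ENNReal.ofReal α < rearr f Q s ↔ s < volume (Q.toSet ∩ {y | α < |f y|}) := by
  have key : ∀ b : ℝ, 0 < b → {x | x ∈ Q.toSet ∧ ENNReal.ofReal b < ENNReal.ofReal |f x|}
      = Q.toSet ∩ {y | b < |f y|} := by
    intro b hb
    ext x
    simp only [mem_setOf_eq, mem_inter_iff, ENNReal.ofReal_lt_ofReal_iff_of_nonneg hb.le]
  constructor
  · intro h
    by_contra hc
    push Not at hc
    refine absurd h (not_lt.2 (sInf_le ?_))
    rw [mem_setOf_eq, key α hα]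
    exact hc
  · intro h
    have hU : Q.toSet ∩ {y | α < |f y|} =
        ⋃ k : ℕ, Q.toSet ∩ {y | α + 1 / ((k : ℝ) + 1) < |f y|} := by
      ext x
      simp only [mem_inter_iff, mem_setOf_eq, mem_iUnion]
      constructor
      · rintro ⟨h1, h2⟩
        obtain ⟨k, hk⟩ := exists_nat_one_div_lt (sub_pos.2 h2)
        exact ⟨k, h1, by linarith⟩
      · rintro ⟨k, h1, h2⟩
        have : 0 < 1 / ((k : ℝ) + 1) := by positivity
        exact ⟨h1, by linarith⟩
    have hm : Monotone fun k : ℕ => Q.toSet ∩ {y | α + 1 / ((k : ℝ) + 1) < |f y|} := by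
      rintro k l hkl x ⟨h1, h2⟩
      refine ⟨h1, ?_⟩
      have h3 : 1 / ((l : ℝ) + 1) ≤ 1 / ((k : ℝ) + 1) := Nat.one_div_le_one_div hkl
      simp only [mem_setOf_eq] at h2 ⊢
      linarith
    rw [hU, hm.measure_iUnion, lt_iSup_iff] at h
    obtain ⟨k, hk⟩ := h
    have hp : 0 < 1 / ((k : ℝ) + 1) := by positivity
    have hb : 0 < α + 1 / ((k : ℝ) + 1) := by linarith
    refine lt_of_lt_of_le ((ENNReal.ofReal_lt_ofReal_iff hb).2 (by linarith : α < _)) ?_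
    refine le_sInf fun a ha => ?_
    by_contra hc
    push Not at hc
    rw [← key _ hb] at hk
    refine absurd (hk.trans_le (measure_mono ?_)) (not_lt.2 ha)
    rintro x ⟨h1, h2⟩
    exact ⟨h1, hc.trans h2⟩

theorem statement11 {n : ℕ} (f : (Fin n → ℝ) → ℝ) (hf : Measurable f)
    (lam : ℝ) (hlam : lam ∈ Ioo (0 : ℝ) 1) (α : ℝ) (hα : 0 < α) :
    {x | ENNReal.ofReal α < medianMax lam f x} =
      {x | ENNReal.ofReal lam <
        hlMaximal ({y | α < |f y|}.indicator fun _ => (1 : ℝ)) x} := by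
  have hS : MeasurableSet {y | α < |f y|} := measurableSet_lt measurable_const hf.abs
  have hI : ∀ Q : RCube n,
      ∫⁻ y in Q.toSet, ENNReal.ofReal |({y | α < |f y|}.indicator fun _ => (1 : ℝ)) y|
        = volume (Q.toSet ∩ {y | α < |f y|}) := by
    intro Q
    have : (fun y => ENNReal.ofReal |({y | α < |f y|}.indicator fun _ => (1 : ℝ)) y|)
        = {y | α < |f y|}.indicator 1 := by
      ext y
      by_cases hy : α < |f y| <;> simp [indicator, hy]
    rw [this, lintegral_indicator_one hS, Measure.restrict_apply hS, inter_comm]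
  ext x
  simp only [mem_setOf_eq, medianMax, hlMaximal, lt_iSup_iff, hI]
  refine exists_congr fun Q => exists_congr fun _ => ?_
  rw [lt_rearr_iff f Q _ α hα]
  have hpos : 0 < Q.side / 2 := by have := Q.side_pos; linarith
  have h0 : volume Q.toSet ≠ 0 := by
    rw [Q.toSet_eq_s11]; exact (Metric.measure_closedBall_pos volume _ hpos).ne'
  have ht : volume Q.toSet ≠ ∞ := by
    rw [Q.toSet_eq_s11]; exact measure_closedBall_lt_top.ne
  rw [ENNReal.lt_div_iff_mul_lt (Or.inl h0) (Or.inl ht)]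
end
end
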